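/- arXiv:0810.3070 — 2 statements merged into one kernel-verified Lean document; each statement's English description precedes it below -/
import Mathlib

section
/- Let T ∈ (0,∞) and α > 0 be fixed, and let (B_t)_{t≥0} be a 1-dimensional standard Wiener process. The process (Y^{(α)}_t)_{t∈[0,T]} defined by Y^{(α)}_t := ∫₀ᵗ ((T−t)/(T−s))^α dB_s for t ∈ [0,T) and Y^{(α)}_T := 0 is a centered Gauss process with almost surely continuous paths. In particular, X^{(α)}_t → 0 almost surely as t ↑ T. -/
open MeasureTheory ProbabilityTheory Filter Set Topology
open scoped ENNReal NNReal

noncomputable section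

variable {Ω : Type*} [MeasurableSpace Ω]

/-- `B` is a standard 1-dimensional Wiener process on the probability space `(Ω, 𝒜, P)`:
it starts at `0`, has a.s. continuous paths, and its increments are independent of the past
and Gaussian with the correct variance. -/
structure IsStandardWiener (P : Measure Ω) (B : ℝ → Ω → ℝ) : Prop where
  meas : ∀ t : ℝ, Measurable (B t)
  init : ∀ᵐ ω ∂P, B 0 ω = 0
  cont : ∀ᵐ ω ∂P, Continuous fun t => B t ω
  incr_indep : ∀ s t : ℝ, 0 ≤ s → s ≤ t →
    IndepFun (fun ω => B t ω - B s ω) (fun ω (u : Set.Icc (0:ℝ) s) => B u.1 ω) P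
  incr_law : ∀ s t : ℝ, 0 ≤ s → s ≤ t →
    Measure.map (fun ω => B t ω - B s ω) P = gaussianReal 0 (Real.toNNReal (t - s))

/-- The `α`-Wiener bridge `X^{(α)}_t = ∫₀ᵗ ((T−t)/(T−s))^α dB_s`, `t ∈ [0,T)`, realized
pathwise through the integration-by-parts representation of the Wiener integral:
`X^{(α)}_t = B_t − α (T−t)^α ∫₀ᵗ (T−s)^{−α−1} B_s ds`. -/
def alphaWienerBridge (T α : ℝ) (B : ℝ → Ω → ℝ) (t : ℝ) (ω : Ω) : ℝ :=
  B t ω - α * (T - t) ^ α * ∫ s in Set.Ioc (0:ℝ) t, (T - s) ^ (-α - 1) * B s ω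

/-- The process `Y^{(α)}` on `[0,T]`: `Y^{(α)}_t = X^{(α)}_t` for `t ∈ [0,T)` and `Y^{(α)}_T = 0`. -/
def bridgeExtension (T α : ℝ) (B : ℝ → Ω → ℝ) (t : ℝ) (ω : Ω) : ℝ :=
  if t < T then alphaWienerBridge T α B t ω else 0

/-- An almost sure limit of centered Gaussian random variables is centered Gaussian. -/
theorem exists_hasLaw_gaussianReal_of_ae_tendsto {P : Measure Ω} [IsProbabilityMeasure P]
    {Z : ℕ → Ω → ℝ} {Z' : Ω → ℝ} (hZ : ∀ n, ∃ v : ℝ≥0, HasLaw (Z n) (gaussianReal 0 v) P)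
    (hlim : ∀ᵐ ω ∂P, Tendsto (fun n => Z n ω) atTop (𝓝 (Z' ω))) :
    ∃ v : ℝ≥0, HasLaw Z' (gaussianReal 0 v) P := by
  choose v hv using hZ
  have hZ' : AEMeasurable Z' P :=
    aemeasurable_of_tendsto_metrizable_ae' (fun n => (hv n).aemeasurable) hlim
  have hφ : ∀ u : ℝ, Tendsto (fun n => Complex.exp (-(v n * u ^ 2 / 2 : ℝ))) atTop
      (𝓝 (charFun (P.map Z') u)) := by
    intro u
    have h1 : ∀ n, Complex.exp (-(v n * u ^ 2 / 2 : ℝ)) =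
        ∫ ω, Complex.exp (u * Z n ω * Complex.I) ∂P := by
      intro n
      have h2 := charFun_gaussianReal (μ := 0) (v := v n) u
      rw [← (hv n).map_eq, charFun_apply_real, integral_map (hv n).aemeasurable
        (by fun_prop)] at h2
      rw [h2]
      push_cast
      ring_nf
    simp_rw [h1]
    rw [charFun_apply_real, integral_map hZ' (by fun_prop)]
    refine tendsto_integral_of_dominated_convergence (fun _ => (1 : ℝ)) (fun n => ?_)
      (integrable_const _) (fun n => ?_) ?_
    · have := (hv n).aemeasurable
      exact AEMeasurable.aestronglyMeasurable (by fun_prop)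
    · refine ae_of_all _ fun ω => ?_
      rw [← Complex.ofReal_mul, Complex.norm_exp_ofReal_mul_I]
    · filter_upwards [hlim] with ω hω
      have hc : Continuous fun x : ℝ => Complex.exp (u * x * Complex.I) := by fun_prop
      exact (hc.tendsto _).comp hω
  have : IsProbabilityMeasure (P.map Z') := Measure.isProbabilityMeasure_map hZ'
  obtain ⟨u₀, hu₀, hne⟩ : ∃ u₀ : ℝ, u₀ ≠ 0 ∧ charFun (P.map Z') u₀ ≠ 0 := by
    have hc : ContinuousAt (charFun (P.map Z')) 0 := continuous_charFun.continuousAt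
    have h0 : charFun (P.map Z') 0 ≠ 0 := by simp
    have h1 : ∀ᶠ u in 𝓝[≠] (0 : ℝ), charFun (P.map Z') u ≠ 0 :=
      (hc.eventually_ne h0).filter_mono nhdsWithin_le_nhds
    obtain ⟨u, hu, hu'⟩ := (h1.and self_mem_nhdsWithin).exists
    exact ⟨u, hu', hu⟩
  have hlog : Tendsto (fun n => -(v n * u₀ ^ 2 / 2 : ℝ)) atTop
      (𝓝 (Real.log ‖charFun (P.map Z') u₀‖)) := by
    have h1 := ((hφ u₀).norm).log (norm_ne_zero_iff.2 hne)
    refine h1.congr fun n => ?_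
    rw [Complex.norm_exp, ← Complex.ofReal_neg, Complex.ofReal_re, Real.log_exp]
  obtain ⟨w, hw⟩ : ∃ w : ℝ, Tendsto (fun n => (v n : ℝ)) atTop (𝓝 w) := by
    refine ⟨_, (hlog.mul_const (-2 / u₀ ^ 2)).congr fun n => ?_⟩
    field_simp
  have hw0 : 0 ≤ w := ge_of_tendsto' hw fun n => (v n).2
  lift w to ℝ≥0 using hw0
  refine ⟨w, hZ', Measure.ext_of_charFun ?_⟩
  ext u
  refine tendsto_nhds_unique (hφ u) ?_
  rw [charFun_gaussianReal]
  have hc : Continuous fun x : ℝ => Complex.exp (-(x * u ^ 2 / 2 : ℝ)) := by fun_prop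
  have hexp : (u * (0 : ℝ) * Complex.I - (w : ℝ) * u ^ 2 / 2 : ℂ) = -(w * u ^ 2 / 2 : ℝ) := by
    push_cast
    ring
  exact hexp ▸ (hc.tendsto (w : ℝ)).comp hw

namespace IsStandardWiener

variable {P : Measure Ω} [IsProbabilityMeasure P] {B : ℝ → Ω → ℝ}

/-- Finite linear combinations of the values of a Wiener process are centered Gaussian. -/
theorem exists_hasLaw_sum (hB : IsStandardWiener P B) (I : Finset ℝ) :
    (∀ u ∈ I, 0 ≤ u) → ∀ a : ℝ → ℝ,
      ∃ v : ℝ≥0, HasLaw (fun ω => ∑ u ∈ I, a u * B u ω) (gaussianReal 0 v) P := by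
  have hincr : ∀ s t : ℝ, 0 ≤ s → s ≤ t → ∀ c : ℝ,
      ∃ v : ℝ≥0, HasLaw (fun ω => c * (B t ω - B s ω)) (gaussianReal 0 v) P := by
    intro s t hs hst c
    have h : HasLaw (fun ω => B t ω - B s ω) (gaussianReal 0 (Real.toNNReal (t - s))) P :=
      ⟨((hB.meas t).sub (hB.meas s)).aemeasurable, hB.incr_law s t hs hst⟩
    have h' := gaussianReal_const_mul h c
    rw [mul_zero] at h'
    exact ⟨_, h'⟩
  induction I using Finset.induction_on_max with
  | empty =>
    intro _ a
    refine ⟨0, by simp, ?_⟩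
    simp [Measure.map_const]
  | insert m I hlt ih =>
    intro hI a
    have hm : m ∉ I := fun h => lt_irrefl _ (hlt m h)
    have hm0 : 0 ≤ m := hI m (Finset.mem_insert_self _ _)
    have hI' : ∀ u ∈ I, 0 ≤ u := fun u hu => hI u (Finset.mem_insert_of_mem hu)
    rcases I.eq_empty_or_nonempty with rfl | hne
    · obtain ⟨v, hv⟩ := hincr 0 m le_rfl hm0 (a m)
      refine ⟨v, hv.congr ?_⟩
      filter_upwards [hB.init] with ω hω
      simp [hω]
    · set s := I.max' hne with hs
      have hsI : s ∈ I := I.max'_mem hne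
      let a' : ℝ → ℝ := fun u => a u + if u = s then a m else 0
      obtain ⟨v₁, hv₁⟩ := hincr s m (hI' s hsI) (hlt s hsI).le (a m)
      obtain ⟨v₂, hv₂⟩ := ih hI' a'
      let g : (Set.Icc (0 : ℝ) s → ℝ) → ℝ := fun x =>
        ∑ u ∈ I.attach, a' u * x ⟨u.1, hI' u u.2, I.le_max' u u.2⟩
      have hg : Measurable g := by fun_prop
      have hind : IndepFun (fun ω => a m * (B m ω - B s ω))
          (fun ω => ∑ u ∈ I, a' u * B u ω) P := by
        have h := (hB.incr_indep s m (hI' s hsI) (hlt s hsI).le).comp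
          (measurable_const_mul (a m)) hg
        have hg' : (fun ω => ∑ u ∈ I, a' u * B u ω) =
            g ∘ fun ω (u : Set.Icc (0 : ℝ) s) => B u.1 ω := by
          ext ω
          exact (Finset.sum_attach I fun u => a' u * B u ω).symm
        rw [hg']
        exact h
      have hsum := gaussianReal_add_gaussianReal_of_indepFun hind hv₁.map_eq hv₂.map_eq
      rw [add_zero] at hsum
      refine ⟨v₁ + v₂, ?_⟩
      have heq : (fun ω => ∑ u ∈ insert m I, a u * B u ω) =
          (fun ω => a m * (B m ω - B s ω)) + fun ω => ∑ u ∈ I, a' u * B u ω := by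
        ext ω
        simp only [Pi.add_apply, a', add_mul, Finset.sum_add_distrib, ite_mul, zero_mul,
          Finset.sum_ite_eq', hsI, if_true, Finset.sum_insert hm]
        ring
      rw [heq]
      exact ⟨hv₁.aemeasurable.add hv₂.aemeasurable, hsum⟩

/-- Elements of the linear span of a Wiener process are centered Gaussian. -/
theorem exists_hasLaw_of_mem_span (hB : IsStandardWiener P B) {Z : Ω → ℝ}
    (hZ : Z ∈ Submodule.span ℝ (B '' Set.Ici 0)) :
    ∃ v : ℝ≥0, HasLaw Z (gaussianReal 0 v) P := by
  obtain ⟨l, hl, rfl⟩ := (Finsupp.mem_span_image_iff_linearCombination ℝ).1 hZ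
  obtain ⟨v, hv⟩ := hB.exists_hasLaw_sum l.support (fun u hu => hl hu) l
  refine ⟨v, ?_⟩
  convert hv using 1
  ext ω
  simp [Finsupp.linearCombination_apply, Finsupp.sum]

end IsStandardWiener

/-- Left Riemann sums of a function continuous on `[0, t]` converge to its integral. -/
theorem tendsto_sum_range_mul_setIntegral {g : ℝ → ℝ} {t : ℝ} (ht : 0 ≤ t)
    (hg : ContinuousOn g (Set.Icc 0 t)) :
    Tendsto (fun n : ℕ => ∑ k ∈ Finset.range n, t / n * g (k * (t / n))) atTop
      (𝓝 (∫ s in Set.Ioc (0 : ℝ) t, g s)) := by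
  rw [← intervalIntegral.integral_of_le ht, Metric.tendsto_atTop]
  intro ε hε
  have hε' : 0 < ε / (t + 1) := by positivity
  obtain ⟨δ, hδ, hgδ⟩ := Metric.uniformContinuousOn_iff_le.1
    (isCompact_Icc.uniformContinuousOn_of_continuous hg) _ hε'
  obtain ⟨N, hN⟩ := exists_nat_gt (t / δ)
  refine ⟨N + 1, fun n hn => ?_⟩
  have hn0 : (0 : ℝ) < n := by exact_mod_cast (by omega : 0 < n)
  have hNn : (N : ℝ) ≤ n := by exact_mod_cast (by omega : N ≤ n)
  set h := t / n with hh
  have hh0 : 0 ≤ h := by positivity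
  have hhδ : h ≤ δ := by
    rw [hh, div_le_iff₀ hn0]
    rw [div_lt_iff₀ hδ] at hN
    nlinarith
  have hnh : n * h = t := by rw [hh]; field_simp
  have hmem : ∀ k < n, Set.Icc (k * h) ((k + 1 : ℕ) * h) ⊆ Set.Icc 0 t := by
    intro k hk x hx
    have hk' : ((k + 1 : ℕ) : ℝ) ≤ n := by exact_mod_cast hk
    refine ⟨le_trans (by positivity) hx.1, hx.2.trans ?_⟩
    rw [← hnh]
    gcongr
  have hle : ∀ k : ℕ, (k : ℝ) * h ≤ (k + 1 : ℕ) * h := by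
    intro k
    gcongr
    simp
  have hint : ∀ k < n, IntervalIntegrable g volume (k * h) ((k + 1 : ℕ) * h) := fun k hk =>
    ContinuousOn.intervalIntegrable_of_Icc (hle k) (hg.mono (hmem k hk))
  have hsplit := intervalIntegral.sum_integral_adjacent_intervals
    (a := fun k : ℕ => (k : ℝ) * h) (n := n) hint
  simp only [Nat.cast_zero, zero_mul, hnh] at hsplit
  rw [← hsplit, dist_comm, Real.dist_eq, ← Finset.sum_sub_distrib]
  have hterm : ∀ k ∈ Finset.range n,
      |(∫ x in (k * h : ℝ)..((k + 1 : ℕ) * h), g x) - h * g (k * h)| ≤ ε / (t + 1) * h := by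
    intro k hk
    have hk := Finset.mem_range.1 hk
    have hlen : ((k + 1 : ℕ) : ℝ) * h - k * h = h := by push_cast; ring
    have hconst : h * g (k * h) = ∫ _ in (k * h : ℝ)..((k + 1 : ℕ) * h), g (k * h) := by
      rw [intervalIntegral.integral_const, hlen, smul_eq_mul]
    rw [hconst, ← intervalIntegral.integral_sub (hint k hk) (by simp), ← Real.norm_eq_abs]
    refine (intervalIntegral.norm_integral_le_of_norm_le_const (C := ε / (t + 1))
      fun x hx => ?_).trans_eq ?_
    · rw [Set.uIoc_of_le (hle k)] at hx
      refine hgδ x (hmem k hk ⟨hx.1.le, hx.2⟩) _ (hmem k hk ⟨le_rfl, hle k⟩) ?_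
      rw [Real.dist_eq, abs_of_nonneg (by linarith [hx.1])]
      linarith [hx.2]
    · rw [hlen, abs_of_nonneg hh0]
  calc _ ≤ ∑ k ∈ Finset.range n, ε / (t + 1) * h :=
        (Finset.abs_sum_le_sum_abs _ _).trans (Finset.sum_le_sum hterm)
    _ = ε * (t / (t + 1)) := by
        rw [Finset.sum_const, Finset.card_range, nsmul_eq_mul, ← hnh]
        ring
    _ < ε := by
        refine mul_lt_of_lt_one_right hε ?_
        rw [div_lt_one (by positivity)]
        linarith

/-- The kernel of the pathwise representation is continuous before time `T`. -/
theorem continuousOn_sub_rpow_mul {T r t : ℝ} (ht : t < T) {b : ℝ → ℝ} (hb : Continuous b) :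
    ContinuousOn (fun s => (T - s) ^ r * b s) (Set.Iic t) := by
  refine ContinuousOn.mul (ContinuousOn.rpow_const (by fun_prop) fun s hs => Or.inl ?_)
    hb.continuousOn
  have : s ≤ t := hs
  linarith

/-- Each `bridgeExtension T α B t` is an almost sure limit of linear combinations of `B`. -/
theorem exists_mem_span_tendsto_bridgeExtension {P : Measure Ω} {T α : ℝ} {B : ℝ → Ω → ℝ}
    (hB : IsStandardWiener P B) {t : ℝ} (ht : 0 ≤ t) :
    ∃ L : ℕ → Ω → ℝ, (∀ n, L n ∈ Submodule.span ℝ (B '' Set.Ici 0)) ∧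
      ∀ᵐ ω ∂P, Tendsto (fun n => L n ω) atTop (𝓝 (bridgeExtension T α B t ω)) := by
  have hmem : ∀ u, 0 ≤ u → B u ∈ Submodule.span ℝ (B '' Set.Ici 0) := fun u hu =>
    Submodule.subset_span ⟨u, hu, rfl⟩
  by_cases htT : t < T
  · refine ⟨fun n => B t - (α * (T - t) ^ α) • ∑ k ∈ Finset.range n,
      (t / n * (T - k * (t / n)) ^ (-α - 1)) • B (k * (t / n)), fun n => ?_, ?_⟩
    · refine Submodule.sub_mem _ (hmem t ht) (Submodule.smul_mem _ _
        (Submodule.sum_mem _ fun k _ => Submodule.smul_mem _ _ (hmem _ (by positivity))))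
    · filter_upwards [hB.cont] with ω hω
      have h := tendsto_sum_range_mul_setIntegral ht
        ((continuousOn_sub_rpow_mul (r := -α - 1) htT hω).mono Set.Icc_subset_Iic_self)
      simp only [bridgeExtension, htT, if_true, alphaWienerBridge]
      refine ((h.const_mul (α * (T - t) ^ α)).const_sub (B t ω)).congr fun n => ?_
      simp [mul_assoc]
  · refine ⟨fun _ => 0, fun _ => Submodule.zero_mem _, ae_of_all _ fun ω => ?_⟩
    simp [bridgeExtension, htT]

/-- Finite linear combinations of the extended bridge are centered Gaussian. -/
theorem exists_hasLaw_sum_bridgeExtension {P : Measure Ω} [IsProbabilityMeasure P] {T α : ℝ}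
    {B : ℝ → Ω → ℝ} (hB : IsStandardWiener P B) {n : ℕ} (ts c : Fin n → ℝ) (hts : ∀ i, 0 ≤ ts i) :
    ∃ v : ℝ≥0, HasLaw (fun ω => ∑ i, c i * bridgeExtension T α B (ts i) ω)
      (gaussianReal 0 v) P := by
  choose L hL hlim using fun i =>
    exists_mem_span_tendsto_bridgeExtension (T := T) (α := α) hB (hts i)
  refine exists_hasLaw_gaussianReal_of_ae_tendsto (Z := fun m => ∑ i, c i • L i m)
    (fun m => hB.exists_hasLaw_of_mem_span
      (Submodule.sum_mem _ fun i _ => Submodule.smul_mem _ _ (hL i m))) ?_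
  filter_upwards [ae_all_iff.2 hlim] with ω hω
  simp only [Finset.sum_apply, Pi.smul_apply, smul_eq_mul]
  exact tendsto_finsetSum _ fun i _ => (hω i).const_mul (c i)

/-- `α (T - t) ^ α ∫ₐᵗ (T - s) ^ (-α - 1) ds = 1 - ((T - t) / (T - a)) ^ α`. -/
theorem mul_integral_sub_rpow {T α a t : ℝ} (hα : 0 < α) (hat : a ≤ t) (ht : t < T) :
    α * (T - t) ^ α * ∫ s in a..t, (T - s) ^ (-α - 1) = 1 - (T - t) ^ α * (T - a) ^ (-α) := by
  have h0 : (0 : ℝ) ∉ Set.uIcc (T - t) (T - a) := by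
    rw [Set.uIcc_of_le (by linarith)]
    exact fun h => by linarith [h.1]
  rw [intervalIntegral.integral_comp_sub_left (fun x => x ^ (-α - 1)) T,
    integral_rpow (Or.inr ⟨by linarith, h0⟩), sub_add_cancel]
  have h1 : (T - t) ^ α * (T - t) ^ (-α) = 1 := by
    rw [← Real.rpow_add (by linarith), add_neg_cancel, Real.rpow_zero]
  field_simp
  linarith

/-- The pathwise bridge transform of a path `b` continuous at `T` tends to `0` at `T`. -/
theorem tendsto_bridge_path {T α : ℝ} (hT : 0 < T) (hα : 0 < α) {b : ℝ → ℝ} (hb : Continuous b) :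
    Tendsto (fun t => b t - α * (T - t) ^ α * ∫ s in Set.Ioc (0 : ℝ) t, (T - s) ^ (-α - 1) * b s)
      (𝓝[<] T) (𝓝 0) := by
  have hpow : Tendsto (fun t : ℝ => (T - t) ^ α) (𝓝[<] T) (𝓝 0) := by
    have h : ContinuousAt (fun t : ℝ => (T - t) ^ α) T :=
      ContinuousAt.rpow_const (by fun_prop) (Or.inr hα.le)
    have h' := h.tendsto
    simp only [sub_self, Real.zero_rpow hα.ne'] at h'
    exact h'.mono_left nhdsWithin_le_nhds
  have hbT : Tendsto (fun t => b t - b T) (𝓝[<] T) (𝓝 0) := by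
    have h := (hb.tendsto T).sub_const (b T)
    rw [sub_self] at h
    exact h.mono_left nhdsWithin_le_nhds
  have hcont : Continuous fun s => b s - b T := by fun_prop
  have hint : ∀ {f : ℝ → ℝ}, Continuous f → ∀ {c d : ℝ}, c ≤ d → d < T →
      IntervalIntegrable (fun s => (T - s) ^ (-α - 1) * f s) volume c d := fun hf c d hcd hd =>
    ContinuousOn.intervalIntegrable_of_Icc hcd
      ((continuousOn_sub_rpow_mul hd hf).mono Set.Icc_subset_Iic_self)
  have hrem : Tendsto (fun t => α * (T - t) ^ α *
      ∫ s in (0 : ℝ)..t, (T - s) ^ (-α - 1) * (b s - b T)) (𝓝[<] T) (𝓝 0) := by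
    rw [Metric.tendsto_nhds]
    intro ε hε
    obtain ⟨δ, hδ, hbδ⟩ := Metric.continuous_iff.1 hb T (ε / 2) (by positivity)
    obtain ⟨a, ha, haT⟩ := exists_between (max_lt hT (by linarith : T - δ < T))
    have ha0 : 0 ≤ a := (le_max_left _ _).trans ha.le
    have haδ : T - δ < a := (le_max_right _ _).trans_lt ha
    have hhead : Tendsto (fun t => α * (T - t) ^ α *
        ∫ s in (0 : ℝ)..a, (T - s) ^ (-α - 1) * (b s - b T)) (𝓝[<] T) (𝓝 0) := by
      simpa using (hpow.const_mul α).mul_const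
        (∫ s in (0 : ℝ)..a, (T - s) ^ (-α - 1) * (b s - b T))
    filter_upwards [Metric.tendsto_nhds.1 hhead (ε / 2) (by positivity), self_mem_nhdsWithin,
      mem_nhdsWithin_of_mem_nhds (Ioi_mem_nhds haT)] with t hhead_t htT hat
    have htT : t < T := htT
    have hat : a < t := hat
    rw [Real.dist_eq, sub_zero] at hhead_t ⊢
    rw [← intervalIntegral.integral_add_adjacent_intervals (hint hcont ha0 haT)
      (hint hcont hat.le htT), mul_add]
    have hcoef : 0 ≤ α * (T - t) ^ α := mul_nonneg hα.le (Real.rpow_nonneg (by linarith) _)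
    have htail : |α * (T - t) ^ α * ∫ s in a..t, (T - s) ^ (-α - 1) * (b s - b T)| ≤ ε / 2 := by
      have hk : IntervalIntegrable (fun s => (T - s) ^ (-α - 1) * (ε / 2)) volume a t :=
        hint continuous_const hat.le htT
      have hnorm : ‖∫ s in a..t, (T - s) ^ (-α - 1) * (b s - b T)‖ ≤
          ∫ s in a..t, (T - s) ^ (-α - 1) * (ε / 2) := by
        refine intervalIntegral.norm_integral_le_of_norm_le hat.le
          (ae_of_all _ fun s hs => ?_) hk
        have h1 : 0 ≤ (T - s) ^ (-α - 1) := Real.rpow_nonneg (by linarith [hs.2]) _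
        rw [norm_mul, Real.norm_of_nonneg h1]
        refine mul_le_mul_of_nonneg_left ?_ h1
        refine (hbδ s ?_).le
        rw [Real.dist_eq, abs_lt]
        constructor <;> linarith [hs.1, hs.2]
      rw [abs_mul, abs_of_nonneg hcoef]
      refine (mul_le_mul_of_nonneg_left hnorm hcoef).trans ?_
      rw [intervalIntegral.integral_mul_const, ← mul_assoc, mul_integral_sub_rpow hα hat.le htT]
      have h2 : 0 ≤ (T - t) ^ α * (T - a) ^ (-α) :=
        mul_nonneg (Real.rpow_nonneg (by linarith) _) (Real.rpow_nonneg (by linarith) _)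
      nlinarith
    calc _ ≤ _ := abs_add_le _ _
      _ < ε / 2 + ε / 2 := add_lt_add_of_lt_of_le hhead_t htail
      _ = ε := by ring
  have hmain : Tendsto (fun t => (b t - b T) + b T * ((T - t) ^ α * T ^ (-α)) -
      α * (T - t) ^ α * ∫ s in (0 : ℝ)..t, (T - s) ^ (-α - 1) * (b s - b T)) (𝓝[<] T) (𝓝 0) := by
    simpa using (hbT.add ((hpow.mul_const (T ^ (-α))).const_mul (b T))).sub hrem
  refine hmain.congr' ?_
  filter_upwards [self_mem_nhdsWithin, mem_nhdsWithin_of_mem_nhds (Ioi_mem_nhds hT)]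
    with t htT ht0
  have htT : t < T := htT
  have ht0 : 0 < t := ht0
  rw [← intervalIntegral.integral_of_le ht0.le]
  have hsub : ∫ s in (0 : ℝ)..t, (T - s) ^ (-α - 1) * (b s - b T) =
      (∫ s in (0 : ℝ)..t, (T - s) ^ (-α - 1) * b s) -
        (∫ s in (0 : ℝ)..t, (T - s) ^ (-α - 1)) * b T := by
    rw [← intervalIntegral.integral_mul_const, ← intervalIntegral.integral_sub
      (hint hb ht0.le htT) (hint continuous_const ht0.le htT)]
    simp_rw [mul_sub]
  have hker := mul_integral_sub_rpow hα ht0.le htT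
  rw [sub_zero] at hker
  rw [hsub]
  linear_combination b T * hker

/-- Before time `T` the bridge of a continuous path is continuous. -/
theorem continuousWithinAt_bridge_path {T α t₀ : ℝ} (hα : 0 < α) {b : ℝ → ℝ}
    (hb : Continuous b) (h0 : 0 ≤ t₀) (ht₀ : t₀ < T) :
    ContinuousWithinAt
      (fun t => b t - α * (T - t) ^ α * ∫ s in Set.Ioc (0 : ℝ) t, (T - s) ^ (-α - 1) * b s)
      (Set.Icc 0 T) t₀ := by
  obtain ⟨t₁, h01, h1T⟩ := exists_between ht₀
  have hprim : ContinuousOn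
      (fun t => ∫ s in Set.Ioc (0 : ℝ) t, (T - s) ^ (-α - 1) * b s) (Set.Icc 0 t₁) :=
    intervalIntegral.continuousOn_primitive
      ((continuousOn_sub_rpow_mul h1T hb).mono Set.Icc_subset_Iic_self).integrableOn_Icc
  have hpow : ContinuousOn (fun t : ℝ => α * (T - t) ^ α) (Set.Icc 0 t₁) :=
    continuousOn_const.mul (ContinuousOn.rpow_const (by fun_prop) fun _ _ => Or.inr hα.le)
  have h := (hb.continuousOn.sub (hpow.mul hprim)) t₀ ⟨h0, h01.le⟩
  refine h.mono_of_mem_nhdsWithin ?_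
  filter_upwards [self_mem_nhdsWithin, mem_nhdsWithin_of_mem_nhds (Iio_mem_nhds h01)] with t ht ht'
  exact ⟨ht.1, le_of_lt ht'⟩

/-- For `T ∈ (0,∞)` and `α > 0`, the process `(Y^{(α)}_t)_{t∈[0,T]}` is a
centered Gauss process with almost surely continuous paths on `[0,T]`; in particular
`X^{(α)}_t → 0` almost surely as `t ↑ T`. -/
theorem bridgeExtension_centered_gauss_continuous
    (P : Measure Ω) [IsProbabilityMeasure P]
    (T α : ℝ) (hT : 0 < T) (hα : 0 < α) (B : ℝ → Ω → ℝ) (hB : IsStandardWiener P B) :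
    (∀ (n : ℕ) (ts : Fin n → ℝ) (c : Fin n → ℝ), (∀ i, ts i ∈ Set.Icc (0:ℝ) T) →
      ∃ v : ℝ≥0, Measure.map (fun ω => ∑ i, c i * bridgeExtension T α B (ts i) ω) P =
        gaussianReal 0 v) ∧
    (∀ t ∈ Set.Icc (0:ℝ) T, ∫ ω, bridgeExtension T α B t ω ∂P = 0) ∧
    (∀ᵐ ω ∂P, ContinuousOn (fun t => bridgeExtension T α B t ω) (Set.Icc 0 T)) ∧
    (∀ᵐ ω ∂P, Tendsto (fun t => alphaWienerBridge T α B t ω) (𝓝[<] T) (𝓝 0)) := by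
  have hgauss := fun (n : ℕ) (ts c : Fin n → ℝ) (hts : ∀ i, ts i ∈ Set.Icc (0:ℝ) T) =>
    exists_hasLaw_sum_bridgeExtension (T := T) (α := α) hB ts c fun i => (hts i).1
  have hlim : ∀ᵐ ω ∂P, Tendsto (fun t => alphaWienerBridge T α B t ω) (𝓝[<] T) (𝓝 0) := by
    filter_upwards [hB.cont] with ω hω
    exact tendsto_bridge_path hT hα hω
  refine ⟨fun n ts c hts => ?_, fun t ht => ?_, ?_, hlim⟩
  · obtain ⟨v, hv⟩ := hgauss n ts c hts
    exact ⟨v, hv.map_eq⟩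
  · obtain ⟨v, hv⟩ := hgauss 1 (fun _ => t) (fun _ => 1) fun _ => ht
    simpa using hv.integral_eq
  · filter_upwards [hB.cont, hlim] with ω hω hlimω t₀ ht₀
    rcases ht₀.2.lt_or_eq with hlt | rfl
    · refine (continuousWithinAt_bridge_path hα hω ht₀.1 hlt).congr_of_eventuallyEq ?_
        (if_pos hlt)
      filter_upwards [mem_nhdsWithin_of_mem_nhds (Iio_mem_nhds hlt)] with t ht
      exact if_pos ht
    · have hval : bridgeExtension t₀ α B t₀ ω = 0 := by simp [bridgeExtension]
      have hIic : 𝓝[Set.Iic t₀] t₀ = 𝓝[<] t₀ ⊔ pure t₀ := by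
        rw [← Set.Iio_insert, nhdsWithin_insert, sup_comm]
      have h : Tendsto (fun t => bridgeExtension t₀ α B t ω) (𝓝[Set.Iic t₀] t₀) (𝓝 0) := by
        rw [hIic, tendsto_sup]
        refine ⟨hlimω.congr' ?_, ?_⟩
        · filter_upwards [self_mem_nhdsWithin] with t ht
          exact (if_pos ht).symm
        · rw [← hval]
          exact tendsto_pure_nhds _ _
      rw [ContinuousWithinAt, hval]
      exact h.mono_left (nhdsWithin_mono _ Set.Icc_subset_Iic_self)
end
end

section
/- If α > 1/2, then P( limsup_{t↑T} X^{(α)}_t / √((2(T−t)/(2α−1)) ln(ln(1/(T−t)))) = 1 ) = P( liminf_{t↑T} X^{(α)}_t / √((2(T−t)/(2α−1)) ln(ln(1/(T−t)))) = −1 ) = 1. In particular, P( limsup_{t↑T} X^{(α)}_t/(T−t)^α = ∞ ) = P( liminf_{t↑T} X^{(α)}_t/(T−t)^α = −∞ ) = 1. -/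
open MeasureTheory ProbabilityTheory Filter Set Topology
open scoped ENNReal NNReal

noncomputable section

variable {Ω : Type*} [MeasurableSpace Ω]

/-- The σ-algebra generated by the path of `B` on `[0, s]`. -/
abbrev pathSigma {Ω : Type*} (B : ℝ → Ω → ℝ) (s : ℝ) : MeasurableSpace Ω :=
  MeasurableSpace.comap (fun ω (u : Set.Icc (0:ℝ) s) => B u.1 ω) MeasurableSpace.pi

lemma measurable_pathSigma {Ω : Type*} (B : ℝ → Ω → ℝ) {s u : ℝ} (hu : u ∈ Set.Icc (0:ℝ) s) :
    Measurable[pathSigma B s] (B u) := by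
  have h1 : Measurable[pathSigma B s] (fun ω (u : Set.Icc (0:ℝ) s) => B u.1 ω) :=
    comap_measurable _
  exact (measurable_pi_apply (⟨u, hu⟩ : Set.Icc (0:ℝ) s)).comp h1

lemma measurable_sub_pathSigma {Ω : Type*} (B : ℝ → Ω → ℝ) {s u v : ℝ}
    (hu : u ∈ Set.Icc (0:ℝ) s) (hv : v ∈ Set.Icc (0:ℝ) s) :
    Measurable[pathSigma B s] (fun ω => B v ω - B u ω) := by
  let _ := pathSigma B s
  have h1 : Measurable (B v) := measurable_pathSigma B hv
  have h2 : Measurable (B u) := measurable_pathSigma B hu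
  exact h1.sub h2

lemma gaussianReal_Ici_zero (v : ℝ≥0) : (2:ℝ≥0∞)⁻¹ ≤ gaussianReal 0 v (Set.Ici 0) := by
  have h1 : gaussianReal 0 v (Set.Iic 0) = gaussianReal 0 v (Set.Ici 0) := by
    have h : (gaussianReal 0 v).map (fun x => -x) = gaussianReal 0 v := by
      rw [gaussianReal_map_neg, neg_zero]
    conv_rhs => rw [← h]
    rw [Measure.map_apply measurable_neg measurableSet_Ici]
    congr 1
    ext x
    simp
  have h2 : (1:ℝ≥0∞) ≤ gaussianReal 0 v (Set.Iic 0) + gaussianReal 0 v (Set.Ici 0) := by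
    rw [← measure_univ (μ := gaussianReal 0 v), ← Set.Iic_union_Ici (a := (0:ℝ))]
    exact measure_union_le _ _
  rw [h1, ← two_mul] at h2
  rw [ENNReal.inv_le_iff_le_mul (by simp) (by simp)]
  exact h2

namespace IsStandardWiener

variable {P : Measure Ω} {B : ℝ → Ω → ℝ}

lemma pathSigma_le (hB : IsStandardWiener P B) (s : ℝ) : pathSigma B s ≤ ‹MeasurableSpace Ω› := by
  rw [pathSigma, ← measurable_iff_comap_le]
  exact measurable_pi_lambda _ fun u => hB.meas u

lemma measurable_incr (hB : IsStandardWiener P B) (s t : ℝ) :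
    Measurable (fun ω => B t ω - B s ω) :=
  (hB.meas t).sub (hB.meas s)

lemma indep_pathSigma (hB : IsStandardWiener P B) {s t : ℝ} (hs : 0 ≤ s) (hst : s ≤ t)
    {A : Set Ω} (hA : MeasurableSet[pathSigma B s] A) {S : Set ℝ} (hS : MeasurableSet S) :
    P (A ∩ {ω | B t ω - B s ω ∈ S}) = P A * P {ω | B t ω - B s ω ∈ S} := by
  have h := (Indep_iff _ _ _).1 ((IndepFun_iff_Indep _ _ _).1 (hB.incr_indep s t hs hst))
    {ω | B t ω - B s ω ∈ S} A ⟨S, hS, rfl⟩ hA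
  rw [Set.inter_comm, h, mul_comm]

lemma neg (hB : IsStandardWiener P B) : IsStandardWiener P (fun t ω => -B t ω) where
  meas t := (hB.meas t).neg
  init := by filter_upwards [hB.init] with ω h; simp [h]
  cont := by filter_upwards [hB.cont] with ω h; exact h.neg
  incr_indep s t hs hst := by
    have h := (hB.incr_indep s t hs hst).comp (φ := fun x : ℝ => -x)
      (ψ := fun (f : Set.Icc (0:ℝ) s → ℝ) u => -f u) measurable_neg
      (measurable_pi_lambda _ fun u => (measurable_pi_apply u).neg)
    convert h using 1
    · ext ω
      simp only [Function.comp]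
      ring
    · rfl
  incr_law s t hs hst := by
    have h : (fun ω => -B t ω - -B s ω) = (fun x => -x) ∘ (fun ω => B t ω - B s ω) := by
      ext ω
      simp only [Function.comp]
      ring
    rw [h, ← Measure.map_map measurable_neg (hB.measurable_incr s t),
      hB.incr_law s t hs hst, gaussianReal_map_neg, neg_zero]

lemma measure_incr (hB : IsStandardWiener P B) {s t : ℝ} (hs : 0 ≤ s) (hst : s ≤ t)
    {S : Set ℝ} (hS : MeasurableSet S) :
    P {ω | B t ω - B s ω ∈ S} = gaussianReal 0 (Real.toNNReal (t - s)) S := by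
  rw [← hB.incr_law s t hs hst, Measure.map_apply (hB.measurable_incr s t) hS]
  rfl

/-- Discrete reflection inequality. -/
lemma measure_exists_le_two_mul (hB : IsStandardWiener P B) {t : ℕ → ℝ} (ht0 : ∀ k, 0 ≤ t k)
    (ht : Monotone t) (n : ℕ) (a : ℝ) :
    P {ω | ∃ k ≤ n, a ≤ B (t k) ω} ≤ 2 * P {ω | a ≤ B (t n) ω} := by
  set A : ℕ → Set Ω := fun k => {ω | a ≤ B (t k) ω} with hA
  have hAm : ∀ j k, j ≤ k → MeasurableSet[pathSigma B (t k)] (A j) := fun j k hjk =>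
    (measurable_pathSigma B ⟨ht0 j, ht hjk⟩) measurableSet_Ici
  have hD : ∀ k, MeasurableSet[pathSigma B (t k)] (disjointed A k) := fun k => by
    rw [disjointed_eq_inter_compl]
    refine MeasurableSet.inter (hAm k k le_rfl) ?_
    refine MeasurableSet.iInter fun j => MeasurableSet.iInter fun hj => ?_
    exact (hAm j k hj.le).compl
  have hD' : ∀ k, MeasurableSet (disjointed A k) := fun k => hB.pathSigma_le _ _ (hD k)
  have hset : {ω | ∃ k ≤ n, a ≤ B (t k) ω} = ⋃ i ∈ Finset.range (n + 1), disjointed A i := by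
    rw [biUnion_range_succ_disjointed, partialSups_eq_biSup]
    ext ω
    simp [hA]
  have hdisj : ((Finset.range (n + 1) : Finset ℕ) : Set ℕ).PairwiseDisjoint (disjointed A) :=
    fun i _ j _ hij => disjoint_disjointed A hij
  have hmeasI : ∀ k, MeasurableSet {ω | B (t n) ω - B (t k) ω ∈ Set.Ici (0:ℝ)} := fun k =>
    hB.measurable_incr _ _ measurableSet_Ici
  have hk : ∀ k ∈ Finset.range (n + 1), P (disjointed A k) ≤
      2 * P (disjointed A k ∩ {ω | B (t n) ω - B (t k) ω ∈ Set.Ici (0:ℝ)}) := fun k hk => by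
    have hkn : t k ≤ t n := ht (Nat.lt_succ_iff.1 (Finset.mem_range.1 hk))
    rw [hB.indep_pathSigma (ht0 k) hkn (hD k) measurableSet_Ici,
      hB.measure_incr (ht0 k) hkn measurableSet_Ici]
    have := gaussianReal_Ici_zero (Real.toNNReal (t n - t k))
    calc P (disjointed A k) = 2 * (P (disjointed A k) * 2⁻¹) := by
          rw [mul_comm (P _), ← mul_assoc, ENNReal.mul_inv_cancel (by simp) (by simp), one_mul]
      _ ≤ _ := by gcongr
  rw [hset, measure_biUnion_finset hdisj fun k _ => hD' k]
  calc _ ≤ ∑ k ∈ Finset.range (n + 1),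
        2 * P (disjointed A k ∩ {ω | B (t n) ω - B (t k) ω ∈ Set.Ici (0:ℝ)}) :=
        Finset.sum_le_sum hk
    _ = 2 * P (⋃ k ∈ Finset.range (n + 1),
          (disjointed A k ∩ {ω | B (t n) ω - B (t k) ω ∈ Set.Ici (0:ℝ)})) := by
        rw [← Finset.mul_sum, measure_biUnion_finset]
        · exact fun i hi j hj hij => (hdisj hi hj hij).mono Set.inter_subset_left
            Set.inter_subset_left
        · exact fun k _ => (hD' k).inter (hmeasI k)
    _ ≤ _ := by
        gcongr
        refine Set.iUnion₂_subset fun k _ ω hω => ?_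
        have h1 : a ≤ B (t k) ω := disjointed_subset A k hω.1
        have h2 : 0 ≤ B (t n) ω - B (t k) ω := hω.2
        change a ≤ B (t n) ω
        linarith

lemma map_eval (hB : IsStandardWiener P B) {t : ℝ} (ht : 0 ≤ t) :
    Measure.map (B t) P = gaussianReal 0 (Real.toNNReal t) := by
  have h := hB.incr_law 0 t le_rfl ht
  rw [sub_zero] at h
  rw [← h]
  refine Measure.map_congr ?_
  filter_upwards [hB.init] with ω hω
  simp [hω]

lemma measure_ge_le (hB : IsStandardWiener P B) [IsProbabilityMeasure P] {t a : ℝ} (ht : 0 < t)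
    (ha : 0 ≤ a) : P {ω | a ≤ B t ω} ≤ ENNReal.ofReal (Real.exp (-a ^ 2 / (2 * t))) := by
  have hmap := hB.map_eval ht.le
  have hint : Integrable (fun ω => Real.exp (a / t * B t ω)) P := by
    have : Integrable (fun x => Real.exp (a / t * x)) (Measure.map (B t) P) := by
      rw [hmap]
      exact integrable_exp_mul_gaussianReal _
    exact this.comp_measurable (hB.meas t)
  have h := measure_ge_le_exp_mul_mgf (μ := P) (X := B t) a (div_nonneg ha ht.le) hint
  rw [mgf_gaussianReal hmap, ← Real.exp_add] at h
  rw [← ENNReal.ofReal_toReal (measure_ne_top P _)]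
  refine ENNReal.ofReal_le_ofReal (h.trans_eq ?_)
  rw [Real.coe_toNNReal _ ht.le]
  congr 1
  field_simp
  ring

lemma measure_exists_Icc_le (hB : IsStandardWiener P B) [IsProbabilityMeasure P]
    (hc : ∀ ω, Continuous fun t => B t ω) {t a : ℝ} (ht : 0 < t) (ha : 0 ≤ a) :
    P {ω | ∃ u ∈ Set.Icc 0 t, a < B u ω} ≤
      2 * ENNReal.ofReal (Real.exp (-a ^ 2 / (2 * t))) := by
  set g : ℕ → ℕ → ℝ := fun m k => (k : ℝ) * t / 2 ^ m with hg
  set E : ℕ → Set Ω := fun m => {ω | ∃ k ≤ 2 ^ m, a ≤ B (g m k) ω} with hE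
  have hmono : Monotone E := by
    refine monotone_nat_of_le_succ fun m ω => ?_
    rintro ⟨k, hk, h⟩
    refine ⟨2 * k, by rw [pow_succ]; omega, ?_⟩
    have : g (m + 1) (2 * k) = g m k := by
      simp only [hg]
      push_cast
      rw [pow_succ]
      field_simp
    rwa [this]
  have hEm : ∀ m, P (E m) ≤ 2 * ENNReal.ofReal (Real.exp (-a ^ 2 / (2 * t))) := fun m => by
    refine (hB.measure_exists_le_two_mul (t := g m) (fun k => ?_) ?_ (2 ^ m) a).trans ?_
    · simp only [hg]; positivity
    · intro i j hij
      simp only [hg]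
      gcongr
    · have : g m (2 ^ m) = t := by
        simp only [hg]
        push_cast
        field_simp
      rw [this]
      gcongr
      exact hB.measure_ge_le ht ha
  have hsub : {ω | ∃ u ∈ Set.Icc 0 t, a < B u ω} ⊆ ⋃ m, E m := by
    rintro ω ⟨u, ⟨hu0, hut⟩, hu⟩
    have hlim : Tendsto (fun m : ℕ => g m ⌊u / t * 2 ^ m⌋₊) atTop (𝓝 u) := by
      have h1 : Tendsto (fun m : ℕ => ((⌊u / t * 2 ^ m⌋₊ : ℝ)) / 2 ^ m) atTop (𝓝 (u / t)) :=
        (tendsto_nat_floor_mul_div_atTop (R := ℝ) (a := u / t) (by positivity)).comp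
          (tendsto_pow_atTop_atTop_of_one_lt (r := (2:ℝ)) (by norm_num))
      have h2 := h1.mul_const t
      rw [div_mul_cancel₀ _ ht.ne'] at h2
      refine h2.congr fun m => ?_
      simp only [hg]
      ring
    have h3 : ∀ᶠ m : ℕ in atTop, a < B (g m ⌊u / t * 2 ^ m⌋₊) ω :=
      ((hc ω).tendsto u).comp hlim |>.eventually (lt_mem_nhds hu)
    obtain ⟨m, hm⟩ := h3.exists
    refine Set.mem_iUnion.2 ⟨m, ⌊u / t * 2 ^ m⌋₊, ?_, hm.le⟩
    refine Nat.floor_le_of_le ?_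
    push_cast
    have : u / t ≤ 1 := (div_le_one ht).2 hut
    nlinarith [pow_pos (two_pos : (0:ℝ) < 2) m]
  calc _ ≤ P (⋃ m, E m) := measure_mono hsub
    _ ≤ _ := by
      refine le_of_tendsto (tendsto_measure_iUnion_atTop hmono) (Eventually.of_forall hEm)

end IsStandardWiener

/-- The scale `√(2 u log log u)` of the law of the iterated logarithm. -/
def lilScale (u : ℝ) : ℝ := Real.sqrt (2 * u * Real.log (Real.log u))

lemma one_le_log_of_exp_le {u : ℝ} (hu : Real.exp 1 ≤ u) : 1 ≤ Real.log u := by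
  rwa [Real.le_log_iff_exp_le ((Real.exp_pos 1).trans_le hu)]

lemma lilScale_le_lilScale {u v : ℝ} (hu : Real.exp 1 ≤ u) (huv : u ≤ v) :
    lilScale u ≤ lilScale v := by
  have h0 : 0 < u := (Real.exp_pos 1).trans_le hu
  have h1 := one_le_log_of_exp_le hu
  have h2 : Real.log u ≤ Real.log v := Real.log_le_log h0 huv
  have h3 : 0 ≤ Real.log (Real.log u) := Real.log_nonneg h1
  have h4 : Real.log (Real.log u) ≤ Real.log (Real.log v) := Real.log_le_log (by linarith) h2
  have h5 : 0 ≤ v := h0.le.trans huv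
  unfold lilScale
  gcongr

lemma IsStandardWiener.ae_eventually_le {P : Measure Ω} [IsProbabilityMeasure P]
    {B : ℝ → Ω → ℝ} (hB : IsStandardWiener P B) (hc : ∀ ω, Continuous fun t => B t ω)
    {ε : ℝ} (hε : 0 < ε) :
    ∀ᵐ ω ∂P, ∀ᶠ u in atTop, B u ω ≤ (1 + ε) * lilScale u := by
  set θ : ℝ := 1 + ε with hθ
  have hθ1 : 1 < θ := by linarith
  have hlogθ : 0 < Real.log θ := Real.log_pos hθ1
  have hpow : Tendsto (fun n : ℕ => θ ^ n) atTop atTop := tendsto_pow_atTop_atTop_of_one_lt hθ1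
  set E : ℕ → Set Ω := fun n =>
    {ω | ∃ u ∈ Set.Icc 0 (θ ^ (n + 1)), (1 + ε) * lilScale (θ ^ n) < B u ω} with hE
  have hlarge : ∀ᶠ n : ℕ in atTop, Real.exp 1 ≤ θ ^ n := hpow.eventually_ge_atTop _
  have hbound : ∀ᶠ n : ℕ in atTop,
      ‖P.real (E n)‖ ≤ 2 * ((Real.log θ) ^ (-θ) * (n : ℝ) ^ (-θ)) := by
    filter_upwards [hlarge, eventually_gt_atTop 0] with n hn hn0
    have h := hB.measure_exists_Icc_le hc (t := θ ^ (n + 1)) (a := (1 + ε) * lilScale (θ ^ n))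
      (by positivity) (mul_nonneg (by linarith) (Real.sqrt_nonneg _))
    rw [Real.norm_of_nonneg measureReal_nonneg]
    have h' := ENNReal.toReal_mono (by finiteness) h
    rw [ENNReal.toReal_mul, ENNReal.toReal_ofReal (Real.exp_nonneg _)] at h'
    refine h'.trans_eq ?_
    have hlog := one_le_log_of_exp_le hn
    have hL : 0 ≤ Real.log (Real.log (θ ^ n)) := Real.log_nonneg hlog
    have hpos : 0 < (n : ℝ) := by exact_mod_cast hn0
    rw [← hθ, mul_pow, lilScale, Real.sq_sqrt (by positivity),
      ← Real.mul_rpow hlogθ.le hpos.le, Real.rpow_def_of_pos (by positivity), Real.log_pow,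
      mul_comm (Real.log θ)]
    simp only [ENNReal.toReal_ofNat]
    congr 2
    rw [pow_succ]
    field_simp
    ring
  have hsum : Summable fun n => P.real (E n) := by
    refine Summable.of_norm_bounded_eventually_nat ?_ hbound
    exact ((Real.summable_nat_rpow.2 (by linarith)).mul_left _).mul_left _
  have htop : ∑' n, P (E n) ≠ ∞ := by
    have := hsum.tsum_ofReal_ne_top
    simpa [Measure.real, ENNReal.ofReal_toReal (measure_ne_top P _)] using this
  filter_upwards [ae_eventually_notMem htop] with ω hω
  obtain ⟨N, hN⟩ := eventually_atTop.1 (hω.and hlarge)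
  filter_upwards [eventually_ge_atTop (θ ^ N), eventually_ge_atTop 1] with u hu hu1
  obtain ⟨n, hn1, hn2⟩ := exists_nat_pow_near hu1 hθ1
  have hNn : N ≤ n := by
    have : θ ^ N < θ ^ (n + 1) := hu.trans_lt hn2
    have := (pow_lt_pow_iff_right₀ hθ1).1 this
    omega
  obtain ⟨h1, h2⟩ := hN n hNn
  have h3 : B u ω ≤ (1 + ε) * lilScale (θ ^ n) := by
    by_contra hcon
    exact h1 ⟨u, ⟨by linarith, hn2.le⟩, not_le.1 hcon⟩
  refine h3.trans ?_
  have := lilScale_le_lilScale h2 hn1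
  gcongr

/-- Lower bound for the upper tail of a centred Gaussian law. -/
lemma ofReal_le_gaussianReal_Ici {v : ℝ≥0} (hv : v ≠ 0) {x : ℝ} (hx : 0 ≤ x) :
    ENNReal.ofReal ((√(2 * Real.pi))⁻¹ * Real.exp (-(x + 1) ^ 2 / 2)) ≤
      gaussianReal 0 v (Set.Ici (√v * x)) := by
  have hvpos : (0:ℝ) < v := by positivity
  have hs : 0 < √(v:ℝ) := Real.sqrt_pos.2 hvpos
  rw [gaussianReal_apply 0 hv]
  have h1 : ∀ y ∈ Set.Icc (√v * x) (√v * (x + 1)),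
      ENNReal.ofReal ((√(2 * Real.pi * v))⁻¹ * Real.exp (-(x + 1) ^ 2 / 2))
        ≤ gaussianPDF 0 v y := fun y hy => by
    rw [gaussianPDF, gaussianPDFReal_def]
    refine ENNReal.ofReal_le_ofReal ?_
    simp only [sub_zero]
    gcongr ?_ * Real.exp ?_
    rw [neg_div, neg_div, neg_le_neg_iff, div_le_div_iff₀ (by positivity) (by positivity)]
    have h0 : 0 ≤ y := (mul_nonneg hs.le hx).trans hy.1
    have : y ^ 2 ≤ (√v * (x + 1)) ^ 2 := pow_le_pow_left₀ h0 hy.2 2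
    rw [mul_pow, Real.sq_sqrt hvpos.le] at this
    nlinarith
  calc _ = ENNReal.ofReal ((√(2 * Real.pi * v))⁻¹ * Real.exp (-(x + 1) ^ 2 / 2)) *
        volume (Set.Icc (√v * x) (√v * (x + 1))) := by
        rw [Real.volume_Icc, ← ENNReal.ofReal_mul (by positivity)]
        congr 1
        rw [Real.sqrt_mul (by positivity : (0:ℝ) ≤ 2 * Real.pi) (v:ℝ)]
        have : 0 < √(2 * Real.pi) := by positivity
        generalize √(2 * Real.pi) = c at *
        field_simp
        ring
    _ = ∫⁻ _ in Set.Icc (√v * x) (√v * (x + 1)),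
        ENNReal.ofReal ((√(2 * Real.pi * v))⁻¹ * Real.exp (-(x + 1) ^ 2 / 2)) := by
        rw [setLIntegral_const]
    _ ≤ ∫⁻ y in Set.Icc (√v * x) (√v * (x + 1)), gaussianPDF 0 v y :=
        setLIntegral_mono (measurable_gaussianPDF _ _) h1
    _ ≤ _ := lintegral_mono_set Set.Icc_subset_Ici_self

/-- Events determined by increments over successive intervals are independent. -/
lemma IsStandardWiener.iIndepSet_incr {P : Measure Ω} [IsProbabilityMeasure P]
    {B : ℝ → Ω → ℝ} (hB : IsStandardWiener P B) {t : ℕ → ℝ} (ht0 : ∀ k, 0 ≤ t k)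
    (ht : Monotone t) {S : ℕ → Set ℝ} (hS : ∀ k, MeasurableSet (S k)) :
    iIndepSet (fun k => {ω | B (t (k + 1)) ω - B (t k) ω ∈ S k}) P := by
  refine (iIndepSet_iff_meas_biInter fun k => hB.measurable_incr _ _ (hS k)).2 ?_
  intro s
  induction s using Finset.induction_on_max with
  | empty => simp
  | insert a s has ih =>
    have ha : a ∉ s := fun h => (has a h).false
    rw [Finset.prod_insert ha, Finset.set_biInter_insert, ← ih, Set.inter_comm, mul_comm]
    refine hB.indep_pathSigma (ht0 a) (ht a.le_succ) ?_ (hS a)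
    refine Finset.measurableSet_biInter _ fun k hk => ?_
    have h1 : Measurable[pathSigma B (t a)] (fun ω => B (t (k + 1)) ω - B (t k) ω) :=
      measurable_sub_pathSigma B ⟨ht0 _, ht (has k hk).le⟩ ⟨ht0 _, ht (has k hk)⟩
    exact h1 (hS k)

/-- Along the geometric sequence `η ^ (-2 k)`, large increments dominate the scale. -/
lemma eventually_lilScale_pow_le {η : ℝ} (hη : 0 < η) (hη1 : η < 1) :
    ∀ᶠ k : ℕ in atTop, (1 - 4 * η) * lilScale ((η ^ 2)⁻¹ ^ (k + 1)) ≤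
      √((η ^ 2)⁻¹ ^ (k + 1) - (η ^ 2)⁻¹ ^ k) * √(2 * (1 - η) * Real.log (k + 1))
        - 2 * lilScale ((η ^ 2)⁻¹ ^ k) := by
  set θ : ℝ := (η ^ 2)⁻¹ with hθ
  have hη2 : η ^ 2 < 1 := pow_lt_one₀ hη.le hη1 (by norm_num)
  have hθ1 : 1 < θ := (one_lt_inv₀ (by positivity)).2 hη2
  have hθη : θ * η ^ 2 = 1 := inv_mul_cancel₀ (by positivity)
  have hlogθ : 0 < Real.log θ := Real.log_pos hθ1
  have hpow : Tendsto (fun n : ℕ => θ ^ n) atTop atTop := tendsto_pow_atTop_atTop_of_one_lt hθ1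
  have hlog : Tendsto (fun k : ℕ => Real.log ((k:ℝ) + 1)) atTop atTop :=
    Real.tendsto_log_atTop.comp
      (tendsto_atTop_add_const_right _ _ tendsto_natCast_atTop_atTop)
  filter_upwards [hpow.eventually_ge_atTop (Real.exp 1),
    hlog.eventually_ge_atTop ((1 - η) * Real.log (Real.log θ) / η),
    eventually_gt_atTop 0] with k hk hl hk0
  have hkpos : (0:ℝ) < k := by exact_mod_cast hk0
  have hl0 : 0 ≤ Real.log ((k:ℝ) + 1) := Real.log_nonneg (by linarith)
  have hθk : 0 < θ ^ k := by positivity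
  have hsucc : θ ^ k = η ^ 2 * θ ^ (k + 1) := by
    rw [pow_succ]
    linear_combination (-θ ^ k) * hθη
  have hle : θ ^ k ≤ θ ^ (k + 1) := pow_le_pow_right₀ hθ1.le k.le_succ
  have hL0 : 0 ≤ Real.log (Real.log (θ ^ k)) := Real.log_nonneg (one_le_log_of_exp_le hk)
  have hL1 : Real.log (Real.log (θ ^ k)) ≤ Real.log (Real.log (θ ^ (k + 1))) :=
    Real.log_le_log (by linarith [one_le_log_of_exp_le hk]) (Real.log_le_log hθk hle)
  have hL : Real.log (Real.log (θ ^ (k + 1))) = Real.log ((k:ℝ) + 1) + Real.log (Real.log θ) := by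
    rw [Real.log_pow]
    push_cast
    rw [Real.log_mul (by positivity) hlogθ.ne']
  have hLl : (1 - η) * Real.log (Real.log (θ ^ (k + 1))) ≤ Real.log ((k:ℝ) + 1) := by
    rw [div_le_iff₀ hη] at hl
    rw [hL]
    linarith
  set L := Real.log (Real.log (θ ^ (k + 1)))
  have hφ1 : lilScale (θ ^ (k + 1)) ^ 2 = 2 * θ ^ (k + 1) * L := by
    rw [lilScale, Real.sq_sqrt]
    have : 0 ≤ L := hL0.trans hL1
    positivity
  have hφ0 : lilScale (θ ^ k) ^ 2 = 2 * θ ^ k * Real.log (Real.log (θ ^ k)) := by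
    rw [lilScale, Real.sq_sqrt]
    positivity
  have hφn : ∀ u, 0 ≤ lilScale u := fun u => Real.sqrt_nonneg _
  have h0 : lilScale (θ ^ k) ≤ η * lilScale (θ ^ (k + 1)) := by
    rw [← pow_le_pow_iff_left₀ (hφn _) (mul_nonneg hη.le (hφn _)) two_ne_zero, mul_pow, hφ0, hφ1]
    calc 2 * θ ^ k * Real.log (Real.log (θ ^ k)) ≤ 2 * θ ^ k * L := by gcongr
      _ = η ^ 2 * (2 * θ ^ (k + 1) * L) := by rw [hsucc]; ring
  have h1 : (1 - η) ^ 2 * lilScale (θ ^ (k + 1)) ≤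
      √(θ ^ (k + 1) - θ ^ k) * √(2 * (1 - η) * Real.log (k + 1)) := by
    have h1η : 0 ≤ 1 - η := by linarith
    rw [← pow_le_pow_iff_left₀ (mul_nonneg (sq_nonneg _) (hφn _)) (by positivity) two_ne_zero,
      mul_pow, mul_pow, hφ1, Real.sq_sqrt (by linarith), Real.sq_sqrt (by positivity), hsucc]
    have hT : 0 ≤ θ ^ (k + 1) := by positivity
    have hLn : 0 ≤ L := hL0.trans hL1
    calc ((1 - η) ^ 2) ^ 2 * (2 * θ ^ (k + 1) * L)
        = 2 * θ ^ (k + 1) * (1 - η) * (1 - η) ^ 2 * ((1 - η) * L) := by ring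
      _ ≤ 2 * θ ^ (k + 1) * (1 - η) * (1 - η ^ 2) * Real.log (k + 1) := by
          gcongr
          nlinarith
      _ = _ := by ring
  nlinarith [hφn (θ ^ (k + 1)), mul_nonneg (sq_nonneg η) (hφn (θ ^ (k + 1)))]

lemma IsStandardWiener.ae_frequently_le {P : Measure Ω} [IsProbabilityMeasure P]
    {B : ℝ → Ω → ℝ} (hB : IsStandardWiener P B) (hc : ∀ ω, Continuous fun t => B t ω)
    {η : ℝ} (hη : 0 < η) (hη1 : η < 1) :
    ∀ᵐ ω ∂P, ∃ᶠ u in atTop, (1 - 4 * η) * lilScale u ≤ B u ω := by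
  set θ : ℝ := (η ^ 2)⁻¹ with hθ
  have hη2 : η ^ 2 < 1 := pow_lt_one₀ hη.le hη1 (by norm_num)
  have hθ1 : 1 < θ := (one_lt_inv₀ (by positivity)).2 hη2
  have hpow : Tendsto (fun n : ℕ => θ ^ n) atTop atTop := tendsto_pow_atTop_atTop_of_one_lt hθ1
  have hpos : ∀ k, 0 ≤ θ ^ k := fun k => by positivity
  have hlt : ∀ k, θ ^ k < θ ^ (k + 1) := fun k => pow_lt_pow_right₀ hθ1 k.lt_succ_self
  set x : ℕ → ℝ := fun k => √(2 * (1 - η) * Real.log (k + 1)) with hx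
  set S : ℕ → Set ℝ := fun k => Set.Ici (√(θ ^ (k + 1) - θ ^ k) * x k) with hS
  set A : ℕ → Set Ω := fun k => {ω | B (θ ^ (k + 1)) ω - B (θ ^ k) ω ∈ S k} with hA
  have hSm : ∀ k, MeasurableSet (S k) := fun k => measurableSet_Ici
  have hAm : ∀ k, MeasurableSet (A k) := fun k => hB.measurable_incr _ _ (hSm k)
  have hind : iIndepSet A P :=
    hB.iIndepSet_incr hpos (pow_right_mono₀ hθ1.le) hSm
  set C : ℝ := (√(2 * Real.pi))⁻¹ * Real.exp (-(1 + 1 / η) / 2) with hC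
  have hCpos : 0 < C := by positivity
  have hlow : ∀ k : ℕ, C * (1 / ((k + 1 : ℕ) : ℝ)) ≤ (P (A k)).toReal := fun k => by
    have hv : Real.toNNReal (θ ^ (k + 1) - θ ^ k) ≠ 0 := by
      simpa using hlt k
    have h := ofReal_le_gaussianReal_Ici hv (x := x k) (Real.sqrt_nonneg _)
    rw [Real.coe_toNNReal _ (by linarith [hlt k]),
      ← hB.measure_incr (hpos k) (hlt k).le (hSm k)] at h
    rw [← ENNReal.ofReal_le_iff_le_toReal (measure_ne_top P _)]
    refine le_trans (ENNReal.ofReal_le_ofReal ?_) h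
    rw [hC, mul_assoc]
    gcongr
    have hk1 : (0:ℝ) < k + 1 := by positivity
    have hl0 : 0 ≤ Real.log ((k:ℝ) + 1) := Real.log_nonneg (by linarith [k.cast_nonneg (α := ℝ)])
    have hx2 : x k ^ 2 = 2 * (1 - η) * Real.log (k + 1) :=
      Real.sq_sqrt (mul_nonneg (by linarith) hl0)
    have h2x : 2 * x k ≤ η * x k ^ 2 + 1 / η := by
      have : η * x k ^ 2 + 1 / η - 2 * x k = (η * x k - 1) ^ 2 / η := by
        field_simp
        ring
      have : 0 ≤ (η * x k - 1) ^ 2 / η := by positivity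
      linarith
    push_cast
    rw [one_div ((k:ℝ) + 1), ← Real.exp_log (inv_pos.2 hk1), Real.log_inv, ← Real.exp_add,
      Real.exp_le_exp]
    rw [hx2] at h2x
    nlinarith [mul_nonneg (sq_nonneg η) hl0]
  have htop : ∑' k, P (A k) = ∞ := by
    by_contra hne
    have h1 := ENNReal.summable_toReal hne
    have h2 : Summable fun k : ℕ => C * (1 / ((k + 1 : ℕ) : ℝ)) :=
      Summable.of_nonneg_of_le (fun k => by positivity) hlow h1
    have h3 := (summable_mul_left_iff hCpos.ne').1 h2
    exact Real.not_summable_one_div_natCast ((summable_nat_add_iff 1).1 h3)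
  have h1 := measure_limsup_eq_one hAm hind htop
  have h2 : ∀ᵐ ω ∂P, ω ∈ limsup A atTop :=
    (mem_ae_iff_prob_eq_one (MeasurableSet.measurableSet_limsup hAm)).2 h1
  filter_upwards [h2, hB.neg.ae_eventually_le (fun ω => (hc ω).neg) one_pos] with ω hω hneg
  rw [mem_limsup_iff_frequently_mem] at hω
  have h3 := hpow.eventually hneg
  have h4 := hω.and_eventually (h3.and (eventually_lilScale_pow_le hη hη1))
  refine ((hpow.comp (tendsto_add_atTop_nat 1))).frequently (h4.mono ?_)
  rintro k ⟨hk1, hk2, hk3⟩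
  have hk1' : √(θ ^ (k + 1) - θ ^ k) * x k ≤ B (θ ^ (k + 1)) ω - B (θ ^ k) ω := hk1
  simp only [Function.comp]
  linarith

/-- Riemann–Stieltjes sums over uniform partitions converge, whatever the tags. -/
lemma tendsto_sum_mul_sub_integral {g F F' : ℝ → ℝ} {s t : ℝ} (hst : s ≤ t)
    (hg : ContinuousOn g (Set.Icc s t)) (hF : ∀ x ∈ Set.Icc s t, HasDerivAt F (F' x) x)
    (hF' : ContinuousOn F' (Set.Icc s t)) {c : ℕ → ℕ → ℝ}
    (hc : ∀ n i : ℕ, c n i ∈ Set.Icc (s + i * ((t - s) / n)) (s + (i + 1 : ℕ) * ((t - s) / n))) :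
    Tendsto (fun n : ℕ => ∑ i ∈ Finset.range n, g (c n i) *
      (F (s + (i + 1 : ℕ) * ((t - s) / n)) - F (s + i * ((t - s) / n)))) atTop
      (𝓝 (∫ u in s..t, g u * F' u)) := by
  obtain ⟨K, hK⟩ := isCompact_Icc.exists_bound_of_continuousOn hF'
  have hK0 : 0 ≤ K := (norm_nonneg _).trans (hK s ⟨le_rfl, hst⟩)
  have hU := Metric.uniformContinuousOn_iff.1 (isCompact_Icc.uniformContinuousOn_of_continuous hg)
  rw [Metric.tendsto_atTop']
  intro ε hε
  set ε' : ℝ := ε / (K * (t - s) + 1) with hε'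
  have hden : 0 < K * (t - s) + 1 := by
    have := mul_nonneg hK0 (sub_nonneg.2 hst)
    linarith
  have hε'0 : 0 < ε' := by positivity
  obtain ⟨δ, hδ, hgδ⟩ := hU ε' hε'0
  have hlim : Tendsto (fun n : ℕ => (t - s) / (n:ℝ)) atTop (𝓝 0) :=
    tendsto_const_div_atTop_nhds_zero_nat _
  obtain ⟨N, hN⟩ := eventually_atTop.1
    ((hlim.eventually (gt_mem_nhds hδ)).and (eventually_gt_atTop 0))
  refine ⟨N, fun n hn => ?_⟩
  obtain ⟨hnδ, hn0⟩ := hN n hn.le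
  have hnpos : (0:ℝ) < n := by exact_mod_cast hn0
  set h : ℝ := (t - s) / n with hh
  have hh0 : 0 ≤ h := div_nonneg (sub_nonneg.2 hst) hnpos.le
  have hnh : n * h = t - s := by rw [hh]; field_simp
  set p : ℕ → ℝ := fun i => s + i * h with hp
  have hpp : ∀ i, p (i + 1) = p i + h := fun i => by simp only [hp]; push_cast; ring
  have hple : ∀ i, p i ≤ p (i + 1) := fun i => by rw [hpp]; linarith
  have hp0 : p 0 = s := by simp [hp]
  have hpn : p n = t := by simp only [hp]; linarith
  have hpmem : ∀ i ≤ n, p i ∈ Set.Icc s t := fun i hi => by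
    have h1 : (i:ℝ) ≤ n := by exact_mod_cast hi
    have h2 : (i:ℝ) * h ≤ n * h := by gcongr
    have h3 : 0 ≤ (i:ℝ) * h := by positivity
    exact ⟨by simp only [hp]; linarith, by simp only [hp]; linarith⟩
  have hsub : ∀ i < n, Set.Icc (p i) (p (i + 1)) ⊆ Set.Icc s t := fun i hi =>
    Set.Icc_subset_Icc (hpmem i hi.le).1 (hpmem (i + 1) hi).2
  have hgF : ContinuousOn (fun u => g u * F' u) (Set.Icc s t) := hg.mul hF'
  have hint : ∀ i < n, IntervalIntegrable (fun u => g u * F' u) volume (p i) (p (i + 1)) :=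
    fun i hi => ContinuousOn.intervalIntegrable (by
      rw [Set.uIcc_of_le (hple i)]; exact hgF.mono (hsub i hi))
  have hintF : ∀ i < n, IntervalIntegrable F' volume (p i) (p (i + 1)) :=
    fun i hi => ContinuousOn.intervalIntegrable (by
      rw [Set.uIcc_of_le (hple i)]; exact hF'.mono (hsub i hi))
  have hterm : ∀ i ∈ Finset.range n,
      ‖g (c n i) * (F (p (i + 1)) - F (p i)) - ∫ u in (p i)..(p (i + 1)), g u * F' u‖
        ≤ ε' * K * h := fun i hi => by
    have hi := Finset.mem_range.1 hi
    have e1 : F (p (i + 1)) - F (p i) = ∫ u in (p i)..(p (i + 1)), F' u :=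
      (intervalIntegral.integral_eq_sub_of_hasDerivAt
        (fun x hx => hF x (hsub i hi (by rwa [Set.uIcc_of_le (hple i)] at hx))) (hintF i hi)).symm
    rw [e1, ← intervalIntegral.integral_const_mul,
      ← intervalIntegral.integral_sub ((hintF i hi).const_mul _) (hint i hi)]
    have hb := intervalIntegral.norm_integral_le_of_norm_le_const (C := ε' * K)
      (a := p i) (b := p (i + 1)) (f := fun u => g (c n i) * F' u - g u * F' u) ?_
    · rwa [show p (i + 1) - p i = h by rw [hpp]; ring, abs_of_nonneg hh0] at hb
    · intro u hu
      rw [Set.uIoc_of_le (hple i)] at hu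
      have hu' : u ∈ Set.Icc (p i) (p (i + 1)) := Set.Ioc_subset_Icc_self hu
      rw [← sub_mul, norm_mul]
      have hcu : dist (c n i) u < δ := by
        refine lt_of_le_of_lt (Real.dist_le_of_mem_Icc (hc n i) hu') ?_
        have := hpp i
        simp only [hp] at this
        linarith
      have h1 := (hgδ _ (hsub i hi (hc n i)) _ (hsub i hi hu') hcu).le
      rw [Real.dist_eq, ← Real.norm_eq_abs] at h1
      exact mul_le_mul h1 (hK u (hsub i hi hu')) (norm_nonneg _) hε'0.le
  have hsum : ∫ u in s..t, g u * F' u =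
      ∑ i ∈ Finset.range n, ∫ u in (p i)..(p (i + 1)), g u * F' u := by
    rw [intervalIntegral.sum_integral_adjacent_intervals hint, hp0, hpn]
  rw [hsum, dist_eq_norm, ← Finset.sum_sub_distrib]
  calc _ ≤ ∑ i ∈ Finset.range n, ε' * K * h := norm_sum_le_of_le _ hterm
    _ = ε' * (K * (t - s)) := by
      rw [Finset.sum_const, Finset.card_range, nsmul_eq_mul, ← hnh]
      ring
    _ < ε' * (K * (t - s) + 1) := by gcongr; linarith
    _ = ε := by rw [hε']; field_simp

namespace IsStandardWiener

variable {P : Measure Ω} {B : ℝ → Ω → ℝ}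

lemma setIntegral_cexp_sum (hB : IsStandardWiener P B) {p : ℕ → ℝ} (hp0 : 0 ≤ p 0)
    (hp : Monotone p) (w : ℕ → ℝ) (x : ℝ) {A : Set Ω} (hA : MeasurableSet[pathSigma B (p 0)] A)
    (n : ℕ) :
    ∫ ω in A, Complex.exp (x *
        (∑ i ∈ Finset.range n, w i * (B (p (i + 1)) ω - B (p i) ω) : ℝ) * Complex.I) ∂P =
      P.real A * Complex.exp
        (-(∑ i ∈ Finset.range n, w i ^ 2 * (p (i + 1) - p i) : ℝ) * x ^ 2 / 2) := by
  have hAm : MeasurableSet A := hB.pathSigma_le _ _ hA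
  have hpos : ∀ i, 0 ≤ p i := fun i => hp0.trans (hp i.zero_le)
  induction n with
  | zero => simp
  | succ n ih =>
    set R : Ω → ℝ := fun ω => ∑ i ∈ Finset.range n, w i * (B (p (i + 1)) ω - B (p i) ω) with hR
    set D : Ω → ℝ := fun ω => B (p (n + 1)) ω - B (p n) ω with hD
    set Z : Ω → ℂ := A.indicator (fun ω => Complex.exp (x * (R ω : ℝ) * Complex.I)) with hZ
    have hRm : Measurable[pathSigma B (p n)] R := by
      let _ := pathSigma B (p n)
      refine Finset.measurable_fun_sum _ fun i hi => Measurable.const_mul ?_ _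
      have hi := Finset.mem_range.1 hi
      exact measurable_sub_pathSigma B ⟨hpos _, hp hi.le⟩ ⟨hpos _, hp hi⟩
    have hA' : MeasurableSet[pathSigma B (p n)] A := by
      obtain ⟨S, hS, rfl⟩ := hA
      refine (?_ : Measurable[pathSigma B (p n)] (fun ω (u : Set.Icc (0:ℝ) (p 0)) => B u.1 ω)) hS
      let _ := pathSigma B (p n)
      exact measurable_pi_lambda _ fun u =>
        measurable_pathSigma B ⟨u.2.1, u.2.2.trans (hp n.zero_le)⟩
    have hZm : Measurable[pathSigma B (p n)] Z := by
      let _ := pathSigma B (p n)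
      refine Measurable.indicator ?_ hA'
      have : Measurable R := hRm
      fun_prop
    have hind : IndepFun Z (fun ω => Complex.exp (x * (w n * D ω : ℝ) * Complex.I)) P := by
      have h1 : IndepFun Z D P := by
        rw [IndepFun_iff_Indep]
        refine indep_of_indep_of_le_left ?_ hZm.comap_le
        exact ((IndepFun_iff_Indep _ _ _).1
          (hB.incr_indep _ _ (hpos n) (hp n.le_succ))).symm
      exact h1.comp (φ := id) (ψ := fun d : ℝ => Complex.exp (x * (w n * d : ℝ) * Complex.I))
        measurable_id (by fun_prop)
    have hDm : Measurable D := hB.measurable_incr _ _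
    have hprod := hind.integral_mul_eq_mul_integral
      (hZm.mono (hB.pathSigma_le _) le_rfl).aestronglyMeasurable
      (by fun_prop : Measurable _).aestronglyMeasurable
    have hchar : ∫ ω, Complex.exp (x * (w n * D ω : ℝ) * Complex.I) ∂P =
        Complex.exp (-(w n ^ 2 * (p (n + 1) - p n) : ℝ) * x ^ 2 / 2) := by
      have h1 := charFun_gaussianReal (μ := 0) (v := Real.toNNReal (p (n + 1) - p n)) (x * w n)
      rw [← hB.incr_law _ _ (hpos n) (hp n.le_succ), charFun_apply_real,
        integral_map hDm.aemeasurable (by fun_prop)] at h1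
      convert h1 using 2
      · ext ω
        push_cast
        ring_nf
      · have : ((Real.toNNReal (p (n + 1) - p n) : ℝ)) = p (n + 1) - p n :=
          Real.coe_toNNReal _ (sub_nonneg.2 (hp n.le_succ))
        rw [this]
        push_cast
        ring
    have hZint : ∫ ω, Z ω ∂P = P.real A * Complex.exp
        (-(∑ i ∈ Finset.range n, w i ^ 2 * (p (i + 1) - p i) : ℝ) * x ^ 2 / 2) := by
      rw [← ih, hZ, integral_indicator hAm]
    rw [hchar, hZint] at hprod
    rw [← integral_indicator hAm]
    have hleft : A.indicator (fun ω => Complex.exp (x *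
        (∑ i ∈ Finset.range (n + 1), w i * (B (p (i + 1)) ω - B (p i) ω) : ℝ) * Complex.I)) =
        Z * fun ω => Complex.exp (x * (w n * D ω : ℝ) * Complex.I) := by
      ext ω
      by_cases hω : ω ∈ A
      · simp only [Pi.mul_apply, hZ, Set.indicator_of_mem hω, ← Complex.exp_add]
        rw [Finset.sum_range_succ]
        congr 1
        push_cast
        simp only [hR, hD]
        push_cast
        ring
      · simp [hZ, hω]
    rw [hleft, hprod, mul_assoc, ← Complex.exp_add, Finset.sum_range_succ]
    congr 2
    push_cast
    ring

/-- A pointwise limit of linear combinations of increments after time `s` is Gaussian and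
independent of the path up to time `s`. -/
lemma measure_inter_preimage_of_tendsto [IsProbabilityMeasure P] (hB : IsStandardWiener P B)
    {s : ℝ} (hs : 0 ≤ s)
    {p w : ℕ → ℕ → ℝ} (hp0 : ∀ n, p n 0 = s) (hp : ∀ n, Monotone (p n)) {Y : Ω → ℝ}
    (hY : Measurable Y) {v : ℝ≥0}
    (hlim : ∀ ω, Tendsto (fun n => ∑ i ∈ Finset.range n,
      w n i * (B (p n (i + 1)) ω - B (p n i) ω)) atTop (𝓝 (Y ω)))
    (hvar : Tendsto (fun n => ∑ i ∈ Finset.range n, w n i ^ 2 * (p n (i + 1) - p n i)) atTop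
      (𝓝 v))
    {A : Set Ω} (hA : MeasurableSet[pathSigma B s] A) {S : Set ℝ} (hS : MeasurableSet S) :
    P (A ∩ Y ⁻¹' S) = P A * gaussianReal 0 v S := by
  have hAm : MeasurableSet A := hB.pathSigma_le _ _ hA
  have hint : ∀ x : ℝ, ∫ ω in A, Complex.exp (x * (Y ω : ℝ) * Complex.I) ∂P =
      P.real A * Complex.exp (-(v : ℝ) * x ^ 2 / 2) := fun x => by
    have h1 : Tendsto (fun n : ℕ => ∫ ω in A, Complex.exp (x * (∑ i ∈ Finset.range n,
        w n i * (B (p n (i + 1)) ω - B (p n i) ω) : ℝ) * Complex.I) ∂P) atTop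
        (𝓝 (∫ ω in A, Complex.exp (x * (Y ω : ℝ) * Complex.I) ∂P)) := by
      refine tendsto_integral_of_dominated_convergence (fun _ => 1) (fun n => ?_)
        (integrable_const _) (fun n => ?_) ?_
      · have : Measurable fun ω => ∑ i ∈ Finset.range n,
            w n i * (B (p n (i + 1)) ω - B (p n i) ω) :=
          Finset.measurable_fun_sum _ fun i _ => (hB.measurable_incr _ _).const_mul _
        exact Measurable.aestronglyMeasurable (by fun_prop)
      · refine Eventually.of_forall fun ω => ?_
        rw [← Complex.ofReal_mul, Complex.norm_exp_ofReal_mul_I]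
      · refine Eventually.of_forall fun ω => ?_
        have hcont : Continuous fun y : ℝ => Complex.exp (x * (y : ℝ) * Complex.I) := by fun_prop
        exact (hcont.tendsto _).comp (hlim ω)
    have h2 : Tendsto (fun n : ℕ => P.real A * Complex.exp
        (-(∑ i ∈ Finset.range n, w n i ^ 2 * (p n (i + 1) - p n i) : ℝ) * x ^ 2 / 2)) atTop
        (𝓝 (P.real A * Complex.exp (-(v : ℝ) * x ^ 2 / 2))) := by
      have hcont : Continuous fun y : ℝ => P.real A * Complex.exp (-(y : ℝ) * x ^ 2 / 2) := by
        fun_prop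
      exact (hcont.tendsto _).comp hvar
    refine tendsto_nhds_unique h1 (h2.congr fun n => ?_)
    rw [hB.setIntegral_cexp_sum (by rw [hp0]; exact hs) (hp n) (w n) x (by rwa [hp0])]
  have hmeas : Measure.map Y (P.restrict A) = P A • gaussianReal 0 v := by
    have : IsFiniteMeasure (P A • gaussianReal 0 v) := Measure.smul_finite _ (measure_ne_top P A)
    refine Measure.ext_of_charFun ?_
    ext x
    rw [charFun_apply_real, integral_map hY.aemeasurable (by fun_prop), hint,
      charFun_apply_real, integral_smul_measure, ← charFun_apply_real, charFun_gaussianReal]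
    rw [Complex.real_smul]
    congr 2
    simp
    ring
  have h := congrArg (fun m : Measure ℝ => m S) hmeas
  simp only [Measure.smul_apply, smul_eq_mul] at h
  rw [Measure.map_apply hY hS, Measure.restrict_apply (hY hS), Set.inter_comm] at h
  exact h

end IsStandardWiener

/-- The process `∫₀ᵗ (T - s)^(-α) dB_s = X^{(α)}_t / (T - t)^α`, integrated by parts. -/
def bridgeMartingale (T α : ℝ) (B : ℝ → Ω → ℝ) (t : ℝ) (ω : Ω) : ℝ :=
  (T - t) ^ (-α) * B t ω - ∫ u in (0:ℝ)..t, B u ω * (α * (T - u) ^ (-α - 1))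

/-- The clock of `bridgeMartingale`, up to an additive constant. -/
def bridgeClock (T α t : ℝ) : ℝ := (T - t) ^ (-(2 * α - 1)) / (2 * α - 1)

/-- The time change which turns `bridgeMartingale` into a Wiener process. -/
def bridgeTime (T α u : ℝ) : ℝ :=
  T - (T ^ (-(2 * α - 1)) + (2 * α - 1) * max u 0) ^ (-(2 * α - 1)⁻¹)

lemma hasDerivAt_sub_rpow {T t : ℝ} (ht : t < T) (a : ℝ) :
    HasDerivAt (fun u => (T - u) ^ (-a)) (a * (T - t) ^ (-a - 1)) t := by
  have h1 : HasDerivAt (fun u => T - u) (-1) t := (hasDerivAt_id t).const_sub T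
  have h2 := h1.rpow_const (p := -a) (Or.inl (by linarith : T - t ≠ 0))
  convert h2 using 1
  ring

lemma continuousOn_sub_rpow (T a : ℝ) : ContinuousOn (fun u => (T - u) ^ a) (Set.Iio T) :=
  fun _ ht => ContinuousAt.continuousWithinAt
    ((continuousAt_const.sub continuousAt_id).rpow_const
      (Or.inl (sub_ne_zero.2 (Set.mem_Iio.1 ht).ne')))

lemma monotone_uniformPartition {s t : ℝ} (hst : s ≤ t) (n : ℕ) :
    Monotone fun i : ℕ => s + i * ((t - s) / n) := fun i j hij => by
  have : 0 ≤ (t - s) / n := div_nonneg (sub_nonneg.2 hst) n.cast_nonneg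
  have h : (i:ℝ) ≤ j := by exact_mod_cast hij
  simp only
  gcongr

lemma tendsto_sum_bridgeMartingale {Ω : Type*} {T α : ℝ} {B : ℝ → Ω → ℝ} {ω : Ω}
    (hc : Continuous fun t => B t ω) {s t : ℝ} (hs : 0 ≤ s) (hst : s ≤ t) (ht : t < T) :
    Tendsto (fun n : ℕ => ∑ i ∈ Finset.range n,
      (T - (s + (i + 1 : ℕ) * ((t - s) / n))) ^ (-α) *
        (B (s + (i + 1 : ℕ) * ((t - s) / n)) ω - B (s + i * ((t - s) / n)) ω)) atTop
      (𝓝 (bridgeMartingale T α B t ω - bridgeMartingale T α B s ω)) := by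
  have hsub : Set.Icc s t ⊆ Set.Iio T := fun x hx => hx.2.trans_lt ht
  have hF' : ContinuousOn (fun u => α * (T - u) ^ (-α - 1)) (Set.Iio T) :=
    continuousOn_const.mul (continuousOn_sub_rpow T _)
  have h := tendsto_sum_mul_sub_integral (g := fun u => B u ω) hst hc.continuousOn
    (fun x hx => hasDerivAt_sub_rpow (hsub hx) α) (hF'.mono hsub)
    (c := fun n i => s + i * ((t - s) / n))
    (fun n i => ⟨le_rfl, monotone_uniformPartition hst n i.le_succ⟩)
  have h2 := h.const_sub ((T - t) ^ (-α) * B t ω - (T - s) ^ (-α) * B s ω)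
  have hII : ∀ {a b}, 0 ≤ a → a ≤ b → b < T →
      IntervalIntegrable (fun u => B u ω * (α * (T - u) ^ (-α - 1))) volume a b := by
    intro a b _ hab hb
    refine ContinuousOn.intervalIntegrable ?_
    rw [Set.uIcc_of_le hab]
    exact hc.continuousOn.mul (hF'.mono fun x hx => hx.2.trans_lt hb)
  have hsplit := intervalIntegral.integral_add_adjacent_intervals
    (hII le_rfl hs (hst.trans_lt ht)) (hII hs hst ht)
  have hlim : (T - t) ^ (-α) * B t ω - (T - s) ^ (-α) * B s ω -
      ∫ u in s..t, B u ω * (α * (T - u) ^ (-α - 1)) =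
      bridgeMartingale T α B t ω - bridgeMartingale T α B s ω := by
    simp only [bridgeMartingale]
    rw [← hsplit]
    ring
  rw [hlim] at h2
  refine h2.congr' ?_
  filter_upwards [eventually_gt_atTop 0] with n hn
  have hn' : (n:ℝ) ≠ 0 := by positivity
  have htel := Finset.sum_range_sub (fun i : ℕ => (T - (s + i * ((t - s) / n))) ^ (-α) *
    B (s + i * ((t - s) / n)) ω) n
  have e1 : s + n * ((t - s) / n) = t := by field_simp; ring
  have e0 : s + (0:ℕ) * ((t - s) / n) = s := by simp
  simp only [e1, e0] at htel
  rw [← htel, ← Finset.sum_sub_distrib]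
  refine Finset.sum_congr rfl fun i _ => ?_
  ring

lemma tendsto_sum_bridgeClock {T α : ℝ} (hα : 1 / 2 < α) {s t : ℝ} (hst : s ≤ t) (ht : t < T) :
    Tendsto (fun n : ℕ => ∑ i ∈ Finset.range n,
      ((T - (s + (i + 1 : ℕ) * ((t - s) / n))) ^ (-α)) ^ 2 *
        ((s + (i + 1 : ℕ) * ((t - s) / n)) - (s + i * ((t - s) / n)))) atTop
      (𝓝 (bridgeClock T α t - bridgeClock T α s)) := by
  have hβ : 0 < 2 * α - 1 := by linarith
  have hsub : Set.Icc s t ⊆ Set.Iio T := fun x hx => hx.2.trans_lt ht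
  have hg : ContinuousOn (fun u => ((T - u) ^ (-α)) ^ 2) (Set.Icc s t) :=
    ((continuousOn_sub_rpow T _).mono hsub).pow 2
  have h := tendsto_sum_mul_sub_integral hst hg (F := fun x => x) (F' := fun _ => 1)
    (fun x _ => hasDerivAt_id x) continuousOn_const
    (c := fun n i => s + (i + 1 : ℕ) * ((t - s) / n))
    (fun n i => ⟨monotone_uniformPartition hst n i.le_succ, le_rfl⟩)
  have hint : ∫ u in s..t, ((T - u) ^ (-α)) ^ 2 * 1 =
      bridgeClock T α t - bridgeClock T α s := by
    refine intervalIntegral.integral_eq_sub_of_hasDerivAt (f := bridgeClock T α) (fun x hx => ?_) ?_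
    · rw [Set.uIcc_of_le hst] at hx
      have h1 := (hasDerivAt_sub_rpow (hsub hx) (2 * α - 1)).div_const (2 * α - 1)
      have hpos : 0 < T - x := sub_pos.2 (hsub hx)
      have e : ((T - x) ^ (-α)) ^ 2 * 1 =
          (2 * α - 1) * (T - x) ^ (-(2 * α - 1) - 1) / (2 * α - 1) := by
        rw [mul_div_cancel_left₀ _ hβ.ne', mul_one, ← Real.rpow_natCast, ← Real.rpow_mul hpos.le]
        congr 1
        push_cast
        ring
      rw [e]
      exact h1
    · refine ContinuousOn.intervalIntegrable ?_
      rw [Set.uIcc_of_le hst]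
      exact hg.mul continuousOn_const
  rw [hint] at h
  exact h

lemma bridgeClock_mono {T α : ℝ} (hα : 1 / 2 < α) {s t : ℝ} (hst : s ≤ t) (ht : t < T) :
    bridgeClock T α s ≤ bridgeClock T α t := by
  unfold bridgeClock
  have h1 : (T - s) ^ (-(2 * α - 1)) ≤ (T - t) ^ (-(2 * α - 1)) :=
    Real.rpow_le_rpow_of_nonpos (by linarith) (by linarith) (by linarith)
  have : 0 ≤ 2 * α - 1 := by linarith
  gcongr

lemma measurable_bridgeMartingale {Ω : Type*} {B : ℝ → Ω → ℝ}
    (hc : ∀ ω, Continuous fun t => B t ω) {T α r s : ℝ} (hr : 0 ≤ r) (hrs : r ≤ s) (hrT : r < T) :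
    Measurable[pathSigma B s] (bridgeMartingale T α B r) := by
  let _ := pathSigma B s
  have h1 : Measurable fun ω => bridgeMartingale T α B r ω - bridgeMartingale T α B 0 ω := by
    refine measurable_of_tendsto_metrizable (fun n => ?_)
      (tendsto_pi_nhds.2 fun ω => tendsto_sum_bridgeMartingale (hc ω) le_rfl hr hrT)
    refine Finset.measurable_fun_sum _ fun i hi => Measurable.const_mul ?_ _
    have hmono := monotone_uniformPartition hr n
    have hi : i + 1 ≤ n := Finset.mem_range.1 hi
    have hmem : ∀ j ≤ n, (0:ℝ) + j * ((r - 0) / n) ∈ Set.Icc 0 s := fun j hj => by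
      have h0 := hmono j.zero_le
      have h2 := hmono hj
      have hn : (n:ℝ) ≠ 0 := by
        have : 0 < n := by omega
        positivity
      have e : (0:ℝ) + n * ((r - 0) / n) = r := by field_simp; ring
      simp only [e] at h2
      simp only [Nat.cast_zero, zero_mul, add_zero] at h0
      exact ⟨h0, h2.trans hrs⟩
    exact measurable_sub_pathSigma B (hmem i (by omega)) (hmem (i + 1) hi)
  have h2 : Measurable (bridgeMartingale T α B 0) := by
    have : Measurable (B 0) := measurable_pathSigma B ⟨le_rfl, hr.trans hrs⟩
    unfold bridgeMartingale
    simp only [intervalIntegral.integral_same, sub_zero]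
    exact this.const_mul _
  convert h1.add h2 using 1
  ext ω
  simp

lemma continuousOn_bridgeMartingale {Ω : Type*} {T α : ℝ} {B : ℝ → Ω → ℝ} {ω : Ω}
    (hc : Continuous fun t => B t ω) :
    ContinuousOn (fun t => bridgeMartingale T α B t ω) (Set.Ico 0 T) := by
  intro t ht
  set b : ℝ := (t + T) / 2 with hb
  have htb : t < b := by have := ht.2; linarith
  have hbT : b < T := by have := ht.2; linarith
  have hsub : Set.Icc 0 b ⊆ Set.Iio T := fun x hx => hx.2.trans_lt hbT
  have hcont : ContinuousOn (fun t => bridgeMartingale T α B t ω) (Set.Icc 0 b) := by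
    refine (((continuousOn_sub_rpow T _).mono hsub).mul hc.continuousOn).sub ?_
    have h0b : (0:ℝ) ≤ b := ht.1.trans htb.le
    have := intervalIntegral.continuousOn_primitive_interval (μ := volume) (a := 0) (b := b)
      (f := fun u => B u ω * (α * (T - u) ^ (-α - 1))) ?_
    · rwa [Set.uIcc_of_le h0b] at this
    · rw [Set.uIcc_of_le h0b]
      exact (hc.continuousOn.mul (continuousOn_const.mul
        ((continuousOn_sub_rpow T _).mono hsub))).integrableOn_Icc
  refine (hcont t ⟨ht.1, htb.le⟩).mono_of_mem_nhdsWithin ?_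
  refine mem_nhdsWithin.2 ⟨Set.Iio b, isOpen_Iio, htb, fun x hx => ⟨hx.2.1, hx.1.le⟩⟩

lemma bridgeTime_bridgeClock_sub {T α : ℝ} (hα : 1 / 2 < α) {t : ℝ} (ht0 : 0 ≤ t) (ht : t < T) :
    bridgeTime T α (bridgeClock T α t - T ^ (-(2 * α - 1)) / (2 * α - 1)) = t := by
  have hβ : 0 < 2 * α - 1 := by linarith
  have h0 : bridgeClock T α 0 = T ^ (-(2 * α - 1)) / (2 * α - 1) := by simp [bridgeClock]
  have h1 := bridgeClock_mono (T := T) hα ht0 ht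
  rw [h0] at h1
  rw [bridgeTime, max_eq_left (sub_nonneg.2 h1), bridgeClock]
  have e : T ^ (-(2 * α - 1)) + (2 * α - 1) *
      ((T - t) ^ (-(2 * α - 1)) / (2 * α - 1) - T ^ (-(2 * α - 1)) / (2 * α - 1)) =
      (T - t) ^ (-(2 * α - 1)) := by
    field_simp
    ring
  rw [e, ← Real.rpow_mul (by linarith), neg_mul_neg, mul_inv_cancel₀ hβ.ne', Real.rpow_one]
  ring

lemma bridgeTime_base_pos {T α : ℝ} (hT : 0 < T) (hα : 1 / 2 < α)
    (u : ℝ) :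
    0 < T ^ (-(2 * α - 1)) + (2 * α - 1) * max u 0 := by
  have h1 : 0 < T ^ (-(2 * α - 1)) := Real.rpow_pos_of_pos hT _
  have h2 : 0 ≤ (2 * α - 1) * max u 0 := mul_nonneg (by linarith) (le_max_right _ _)
  linarith

lemma bridgeClock_bridgeTime {T α : ℝ} (hT : 0 < T) (hα : 1 / 2 < α)
    (u : ℝ) :
    bridgeClock T α (bridgeTime T α u) = T ^ (-(2 * α - 1)) / (2 * α - 1) + max u 0 := by
  have hβ : 0 < 2 * α - 1 := by linarith
  rw [bridgeClock, bridgeTime, sub_sub_cancel, ← Real.rpow_mul (bridgeTime_base_pos hT hα u).le,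
    neg_mul_neg, inv_mul_cancel₀ hβ.ne', Real.rpow_one]
  field_simp

lemma bridgeTime_lt {T α : ℝ} (hT : 0 < T) (hα : 1 / 2 < α)
    (u : ℝ) : bridgeTime T α u < T := by
  have := Real.rpow_pos_of_pos (bridgeTime_base_pos hT hα u) (-(2 * α - 1)⁻¹)
  unfold bridgeTime
  linarith

lemma bridgeTime_mono {T α : ℝ} (hT : 0 < T) (hα : 1 / 2 < α) :
    Monotone (bridgeTime T α) := fun u v huv => by
  have hβ : 0 < 2 * α - 1 := by linarith
  have h : max u 0 ≤ max v 0 := max_le_max_right _ huv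
  have := Real.rpow_le_rpow_of_nonpos (bridgeTime_base_pos hT hα u)
    (y := T ^ (-(2 * α - 1)) + (2 * α - 1) * max v 0) (by gcongr)
    (neg_nonpos.2 (inv_nonneg.2 hβ.le))
  unfold bridgeTime
  linarith

lemma bridgeTime_of_nonpos {T α : ℝ} (hT : 0 < T) (hα : 1 / 2 < α)
    {u : ℝ} (hu : u ≤ 0) : bridgeTime T α u = 0 := by
  have hβ : 0 < 2 * α - 1 := by linarith
  rw [bridgeTime, max_eq_right hu, mul_zero, add_zero, ← Real.rpow_mul hT.le, neg_mul_neg,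
    mul_inv_cancel₀ hβ.ne', Real.rpow_one, sub_self]

lemma bridgeTime_nonneg {T α : ℝ} (hT : 0 < T) (hα : 1 / 2 < α)
    (u : ℝ) : 0 ≤ bridgeTime T α u := by
  rcases le_total u 0 with hu | hu
  · rw [bridgeTime_of_nonpos hT hα hu]
  · rw [← bridgeTime_of_nonpos hT hα le_rfl]
    exact bridgeTime_mono hT hα hu

lemma continuous_bridgeTime {T α : ℝ} (hT : 0 < T) (hα : 1 / 2 < α) :
    Continuous (bridgeTime T α) := by
  unfold bridgeTime
  refine continuous_const.sub (Continuous.rpow_const ?_ fun u =>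
    Or.inl (bridgeTime_base_pos hT hα u).ne')
  fun_prop

lemma IsStandardWiener.measure_inter_bridgeMartingale {T α : ℝ} (hT : 0 < T) (hα : 1 / 2 < α)
    {P : Measure Ω} [IsProbabilityMeasure P]
    {B : ℝ → Ω → ℝ} (hB : IsStandardWiener P B) (hc : ∀ ω, Continuous fun t => B t ω) {s t : ℝ}
    (hs : 0 ≤ s) (hst : s ≤ t) {A : Set Ω} (hA : MeasurableSet[pathSigma B (bridgeTime T α s)] A)
    {S : Set ℝ} (hS : MeasurableSet S) :
    P (A ∩ (fun ω => bridgeMartingale T α B (bridgeTime T α t) ω -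
      bridgeMartingale T α B (bridgeTime T α s) ω) ⁻¹' S) =
      P A * gaussianReal 0 (Real.toNNReal (t - s)) S := by
  have hts := bridgeTime_mono hT hα hst
  have hs0 := bridgeTime_nonneg hT hα s
  have htT := bridgeTime_lt hT hα t
  have hm : ∀ u, Measurable (bridgeMartingale T α B (bridgeTime T α u)) := fun u =>
    (measurable_bridgeMartingale hc (bridgeTime_nonneg hT hα u) le_rfl
      (bridgeTime_lt hT hα u)).mono (hB.pathSigma_le _) le_rfl
  refine hB.measure_inter_preimage_of_tendsto hs0
    (p := fun n i => bridgeTime T α s + i * ((bridgeTime T α t - bridgeTime T α s) / n))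
    (fun n => by simp) (fun n => monotone_uniformPartition hts n) ((hm t).sub (hm s))
    (fun ω => tendsto_sum_bridgeMartingale (hc ω) hs0 hts htT) ?_ hA hS
  have h := tendsto_sum_bridgeClock hα hts htT
  rw [bridgeClock_bridgeTime hT hα, bridgeClock_bridgeTime hT hα, max_eq_left hs,
    max_eq_left (hs.trans hst), add_sub_add_left_eq_sub] at h
  rw [Real.coe_toNNReal _ (sub_nonneg.2 hst)]
  exact h

lemma continuous_bridgeMartingale_bridgeTime {T α : ℝ} (hT : 0 < T) (hα : 1 / 2 < α)
    {Ω : Type*} {B : ℝ → Ω → ℝ} {ω : Ω}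
    (hc : Continuous fun t => B t ω) :
    Continuous fun u => bridgeMartingale T α B (bridgeTime T α u) ω :=
  (continuousOn_bridgeMartingale hc).comp_continuous (continuous_bridgeTime hT hα)
    fun u => ⟨bridgeTime_nonneg hT hα u, bridgeTime_lt hT hα u⟩

lemma IsStandardWiener.timeChange {T α : ℝ} (hT : 0 < T) (hα : 1 / 2 < α)
    {P : Measure Ω} [IsProbabilityMeasure P]
    {B : ℝ → Ω → ℝ} (hB : IsStandardWiener P B) (hc : ∀ ω, Continuous fun t => B t ω) :
    IsStandardWiener P fun u => bridgeMartingale T α B (bridgeTime T α u) where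
  meas u := (measurable_bridgeMartingale hc (bridgeTime_nonneg hT hα u) le_rfl
      (bridgeTime_lt hT hα u)).mono (hB.pathSigma_le _) le_rfl
  init := by
    filter_upwards [hB.init] with ω hω
    rw [bridgeTime_of_nonpos hT hα le_rfl]
    simp [bridgeMartingale, hω]
  cont := Eventually.of_forall fun ω =>
    continuous_bridgeMartingale_bridgeTime hT hα (hc ω)
  incr_law s t hs hst := by
    ext S hS
    have hm : ∀ u, Measurable (bridgeMartingale T α B (bridgeTime T α u)) := fun u =>
      (measurable_bridgeMartingale hc (bridgeTime_nonneg hT hα u) le_rfl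
        (bridgeTime_lt hT hα u)).mono (hB.pathSigma_le _) le_rfl
    have h := hB.measure_inter_bridgeMartingale hT hα hc hs hst MeasurableSet.univ hS
    rw [measure_univ, one_mul, Set.univ_inter] at h
    have hd : Measurable fun ω => bridgeMartingale T α B (bridgeTime T α t) ω -
        bridgeMartingale T α B (bridgeTime T α s) ω := (hm t).sub (hm s)
    rw [Measure.map_apply hd hS]
    exact h
  incr_indep s t hs hst := by
    rw [IndepFun_iff_Indep, Indep_iff]
    rintro _ A ⟨S, hS, rfl⟩ hA
    have hle : MeasurableSpace.comap (fun ω (u : Set.Icc (0:ℝ) s) =>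
        bridgeMartingale T α B (bridgeTime T α u.1) ω) MeasurableSpace.pi ≤
        pathSigma B (bridgeTime T α s) := by
      rw [← measurable_iff_comap_le]
      let _ := pathSigma B (bridgeTime T α s)
      exact measurable_pi_lambda _ fun u => measurable_bridgeMartingale hc
        (bridgeTime_nonneg hT hα _) (bridgeTime_mono hT hα u.2.2) (bridgeTime_lt hT hα _)
    have h1 := hB.measure_inter_bridgeMartingale hT hα hc hs hst (hle _ hA) hS
    have h2 := hB.measure_inter_bridgeMartingale hT hα hc hs hst MeasurableSet.univ hS
    rw [measure_univ, one_mul, Set.univ_inter] at h2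
    rw [Set.inter_comm, h1, h2, mul_comm]

lemma alphaWienerBridge_eq_rpow_mul {Ω : Type*} {T α : ℝ} (B : ℝ → Ω → ℝ) {t : ℝ} (ht0 : 0 ≤ t)
    (ht : t < T) (ω : Ω) :
    alphaWienerBridge T α B t ω = (T - t) ^ α * bridgeMartingale T α B t ω := by
  have hpos : 0 < T - t := sub_pos.2 ht
  have h1 : (T - t) ^ α * (T - t) ^ (-α) = 1 := by
    rw [← Real.rpow_add hpos, add_neg_cancel, Real.rpow_zero]
  have h2 : (∫ u in (0:ℝ)..t, B u ω * (α * (T - u) ^ (-α - 1))) =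
      α * ∫ u in (0:ℝ)..t, (T - u) ^ (-α - 1) * B u ω := by
    rw [← intervalIntegral.integral_const_mul]
    refine intervalIntegral.integral_congr fun u _ => ?_
    ring
  rw [alphaWienerBridge, bridgeMartingale, h2, ← intervalIntegral.integral_of_le ht0]
  linear_combination (-(B t ω)) * h1

lemma alphaWienerBridge_neg {Ω : Type*} (T α : ℝ) (B : ℝ → Ω → ℝ) (t : ℝ) (ω : Ω) :
    alphaWienerBridge T α (fun t ω => -B t ω) t ω = -alphaWienerBridge T α B t ω := by
  simp only [alphaWienerBridge, mul_neg, integral_neg]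
  ring

lemma tendsto_bridgeTime {T α : ℝ} (hT : 0 < T) (hα : 1 / 2 < α) :
    Tendsto (bridgeTime T α) atTop (𝓝[<] T) := by
  have hβ : 0 < 2 * α - 1 := by linarith
  refine tendsto_nhdsWithin_iff.2 ⟨?_, Eventually.of_forall fun u => bridgeTime_lt hT hα u⟩
  have h1 : Tendsto (fun u : ℝ => T ^ (-(2 * α - 1)) + (2 * α - 1) * max u 0) atTop atTop :=
    tendsto_atTop_add_const_left _ _ (Tendsto.const_mul_atTop hβ
      (tendsto_atTop_mono (fun u => le_max_left u 0) tendsto_id))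
  have h2 := ((tendsto_rpow_neg_atTop (inv_pos.2 hβ)).comp h1).const_sub T
  rw [sub_zero] at h2
  exact h2

lemma tendsto_const_sub_nhdsLT (T : ℝ) : Tendsto (fun t => T - t) (𝓝[<] T) (𝓝[>] 0) := by
  refine tendsto_nhdsWithin_iff.2 ⟨?_, ?_⟩
  · have : Tendsto (fun t => T - t) (𝓝 T) (𝓝 (T - T)) := tendsto_id.const_sub T
    rw [sub_self] at this
    exact this.mono_left nhdsWithin_le_nhds
  · filter_upwards [self_mem_nhdsWithin] with t ht
    exact sub_pos.2 (Set.mem_Iio.1 ht)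

lemma tendsto_bridgeClock_sub {T α : ℝ} (hα : 1 / 2 < α) (c : ℝ) :
    Tendsto (fun t => bridgeClock T α t - c) (𝓝[<] T) atTop := by
  have hβ : 0 < 2 * α - 1 := by linarith
  have h1 := (tendsto_rpow_neg_nhdsGT_zero (neg_lt_zero.2 hβ)).comp (tendsto_const_sub_nhdsLT T)
  exact tendsto_atTop_add_const_right _ (-c) (h1.atTop_div_const hβ)

/-- The scale of the law of the iterated logarithm, at the clock `bridgeClock`, is asymptotic to
the scale at the terminal time. -/
lemma tendsto_rpow_mul_lilScale_div {α : ℝ} (hα : 1 / 2 < α) (c : ℝ) :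
    Tendsto (fun x => x ^ α * lilScale (x ^ (-(2 * α - 1)) / (2 * α - 1) - c) /
      √(2 * x / (2 * α - 1) * Real.log (Real.log (1 / x)))) (𝓝[>] 0) (𝓝 1) := by
  set β := 2 * α - 1 with hβdef
  have hβ : 0 < β := by linarith
  set g : ℝ → ℝ := fun x => 1 / β - c * x ^ β with hg
  set L : ℝ → ℝ := fun x => Real.log (1 / x) with hL
  have hgt : Tendsto g (𝓝[>] 0) (𝓝 (1 / β)) := by
    have h1 : Tendsto (fun x : ℝ => x ^ β) (𝓝[>] 0) (𝓝 0) := by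
      have := (Real.continuousAt_rpow_const 0 β (Or.inr hβ.le)).tendsto
      rw [Real.zero_rpow hβ.ne'] at this
      exact this.mono_left nhdsWithin_le_nhds
    simpa [hg] using (h1.const_mul c).const_sub (1 / β)
  have hLt : Tendsto L (𝓝[>] 0) atTop := by
    simp only [hL, one_div]
    exact Real.tendsto_log_atTop.comp tendsto_inv_nhdsGT_zero
  have hloggt : Tendsto (fun x => Real.log (g x)) (𝓝[>] 0) (𝓝 (Real.log (1 / β))) :=
    hgt.log (by positivity)
  have hb : Tendsto (fun x => β + Real.log (g x) / L x) (𝓝[>] 0) (𝓝 β) := by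
    simpa using (hloggt.div_atTop hLt).const_add β
  have hr : Tendsto (fun x => 1 + Real.log (β + Real.log (g x) / L x) / Real.log (L x))
      (𝓝[>] 0) (𝓝 1) := by
    simpa using ((hb.log hβ.ne').div_atTop (Real.tendsto_log_atTop.comp hLt)).const_add 1
  have hlim : Tendsto (fun x => √(β * g x *
      (1 + Real.log (β + Real.log (g x) / L x) / Real.log (L x)))) (𝓝[>] 0) (𝓝 1) := by
    have h := ((hgt.const_mul β).mul hr).sqrt
    rwa [mul_one_div_cancel hβ.ne', mul_one, Real.sqrt_one] at h
  refine hlim.congr' ?_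
  filter_upwards [self_mem_nhdsWithin, hLt.eventually_gt_atTop 1,
    hgt.eventually (lt_mem_nhds (by positivity : 0 < 1 / β)),
    hb.eventually (lt_mem_nhds hβ)] with x hx hL1 hg0 hb0
  have hx : 0 < x := hx
  have hτ : x ^ (-β) / β - c = x ^ (-β) * g x := by
    have : x ^ (-β) * x ^ β = 1 := by rw [← Real.rpow_add hx, neg_add_cancel, Real.rpow_zero]
    simp only [hg]
    linear_combination c * this
  have hlog : Real.log (x ^ (-β) / β - c) = L x * (β + Real.log (g x) / L x) := by
    rw [hτ, Real.log_mul (Real.rpow_pos_of_pos hx _).ne' hg0.ne', Real.log_rpow hx]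
    have : L x = -Real.log x := by simp [hL]
    rw [mul_add, mul_div_cancel₀ _ (by linarith : L x ≠ 0), this]
    ring
  have hlogL : 0 < Real.log (L x) := Real.log_pos hL1
  have hxα : x ^ α = √(x ^ (2 * α)) := by
    rw [Real.sqrt_eq_rpow, ← Real.rpow_mul hx.le]
    congr 1
    ring
  have hpow : x ^ (2 * α) * x ^ (-β) = x := by
    rw [← Real.rpow_add hx, hβdef]
    conv_rhs => rw [← Real.rpow_one x]
    congr 1
    ring
  rw [lilScale, hlog, Real.log_mul (by linarith) hb0.ne', hτ, hxα,
    ← Real.sqrt_mul (Real.rpow_nonneg hx.le _), ← Real.sqrt_div' _ (by positivity)]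
  congr 1
  have e : x ^ (2 * α) * (2 * (x ^ (-β) * g x) *
      (Real.log (L x) + Real.log (β + Real.log (g x) / L x))) =
      2 * x * g x * (Real.log (L x) + Real.log (β + Real.log (g x) / L x)) := by
    linear_combination 2 * g x *
      (Real.log (L x) + Real.log (β + Real.log (g x) / L x)) * hpow
  rw [e]
  change _ = _ / (2 * x / β * Real.log (L x))
  field_simp

lemma tendsto_lilScale_atTop : Tendsto lilScale atTop atTop := by
  have h1 : Tendsto (fun u : ℝ => Real.log (Real.log u)) atTop atTop :=
    Real.tendsto_log_atTop.comp Real.tendsto_log_atTop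
  exact Real.tendsto_sqrt_atTop.comp
    ((tendsto_id.const_mul_atTop (by norm_num : (0:ℝ) < 2)).atTop_mul_atTop₀ h1)

/-- The law of the iterated logarithm (at infinity) for a Wiener process. -/
lemma IsStandardWiener.ae_lil {P : Measure Ω} [IsProbabilityMeasure P]
    {B : ℝ → Ω → ℝ} (hB : IsStandardWiener P B) (hc : ∀ ω, Continuous fun t => B t ω) :
    ∀ᵐ ω ∂P, (∀ c > 1, ∀ᶠ u in atTop, B u ω ≤ c * lilScale u) ∧
      ∀ c < 1, ∃ᶠ u in atTop, c * lilScale u ≤ B u ω := by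
  have h1 : ∀ᵐ ω ∂P, ∀ n : ℕ, ∀ᶠ u in atTop, B u ω ≤ (1 + 1 / ((n:ℝ) + 1)) * lilScale u :=
    ae_all_iff.2 fun n => hB.ae_eventually_le hc (by positivity)
  have h2 : ∀ᵐ ω ∂P, ∀ n : ℕ, ∃ᶠ u in atTop,
      (1 - 4 * (1 / ((n:ℝ) + 2))) * lilScale u ≤ B u ω :=
    ae_all_iff.2 fun n => hB.ae_frequently_le hc (by positivity) (by
      rw [div_lt_one (by positivity)]
      have : (0:ℝ) ≤ n := n.cast_nonneg
      linarith)
  filter_upwards [h1, h2] with ω hω1 hω2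
  refine ⟨fun c hc1 => ?_, fun c hc1 => ?_⟩
  · obtain ⟨n, hn⟩ := exists_nat_one_div_lt (sub_pos.2 hc1)
    filter_upwards [hω1 n] with u hu
    exact hu.trans (mul_le_mul_of_nonneg_right (by linarith) (Real.sqrt_nonneg _))
  · obtain ⟨n, hn⟩ := exists_nat_one_div_lt (div_pos (sub_pos.2 hc1) (by norm_num : (0:ℝ) < 4))
    refine (hω2 n).mono fun u hu => le_trans ?_ hu
    have : 1 / ((n:ℝ) + 2) ≤ 1 / ((n:ℝ) + 1) := by gcongr; norm_num
    exact mul_le_mul_of_nonneg_right (by linarith) (Real.sqrt_nonneg _)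

lemma limsup_coe_eq_of_forall {ι : Type*} {l : Filter ι} {f : ι → ℝ} {a : ℝ}
    (h1 : ∀ c > a, ∀ᶠ t in l, f t ≤ c) (h2 : ∀ c < a, ∃ᶠ t in l, c ≤ f t) :
    Filter.limsup (fun t => (f t : EReal)) l = a := by
  refine le_antisymm (EReal.le_of_forall_lt_iff_le.1 fun z hz => ?_)
    (EReal.ge_of_forall_gt_iff_ge.1 fun z hz => ?_)
  · exact limsup_le_of_le (h := (h1 z (EReal.coe_lt_coe_iff.1 hz)).mono
      fun t ht => EReal.coe_le_coe_iff.2 ht)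
  · exact le_limsup_of_frequently_le ((h2 z (EReal.coe_lt_coe_iff.1 hz)).mono
      fun t ht => EReal.coe_le_coe_iff.2 ht)

lemma limsup_coe_eq_top_of_forall {ι : Type*} {l : Filter ι} {f : ι → ℝ}
    (h : ∀ c, ∃ᶠ t in l, c ≤ f t) : Filter.limsup (fun t => (f t : EReal)) l = ⊤ :=
  EReal.eq_top_iff_forall_lt _ |>.2 fun z =>
    (EReal.coe_lt_coe_iff.2 (lt_add_one z)).trans_le
      (le_limsup_of_frequently_le ((h (z + 1)).mono fun t ht => EReal.coe_le_coe_iff.2 ht))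

lemma limsup_alphaWienerBridge_of_lil {Ω : Type*} {T α : ℝ} (hT : 0 < T) (hα : 1 / 2 < α)
    {B : ℝ → Ω → ℝ} {ω : Ω}
    (h1 : ∀ c > 1, ∀ᶠ u in atTop, bridgeMartingale T α B (bridgeTime T α u) ω ≤ c * lilScale u)
    (h2 : ∀ c < 1, ∃ᶠ u in atTop, c * lilScale u ≤ bridgeMartingale T α B (bridgeTime T α u) ω) :
    Filter.limsup (fun t => ((alphaWienerBridge T α B t ω /
      √(2 * (T - t) / (2 * α - 1) * Real.log (Real.log (1 / (T - t)))) : ℝ) : EReal))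
        (𝓝[<] T) = 1 ∧
    Filter.limsup (fun t => ((alphaWienerBridge T α B t ω / (T - t) ^ α : ℝ) : EReal))
        (𝓝[<] T) = ⊤ := by
  set K := T ^ (-(2 * α - 1)) / (2 * α - 1) with hK
  set τ : ℝ → ℝ := fun t => bridgeClock T α t - K with hτ
  have hτt : Tendsto τ (𝓝[<] T) atTop := tendsto_bridgeClock_sub hα K
  have hmem : ∀ᶠ t in 𝓝[<] T, 0 ≤ t ∧ t < T :=
    (Ico_mem_nhdsLT hT : Set.Ico 0 T ∈ 𝓝[<] T)
  have hup : ∀ c > 1, ∀ᶠ t in 𝓝[<] T, bridgeMartingale T α B t ω ≤ c * lilScale (τ t) := by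
    intro c hc
    filter_upwards [hτt.eventually (h1 c hc), hmem] with t ht ht'
    rwa [bridgeTime_bridgeClock_sub hα ht'.1 ht'.2] at ht
  have hlow : ∀ c < 1, ∃ᶠ t in 𝓝[<] T, c * lilScale (τ t) ≤ bridgeMartingale T α B t ω := by
    intro c hc
    refine (tendsto_bridgeTime hT hα).frequently
      (((h2 c hc).and_eventually (eventually_ge_atTop 0)).mono fun u hu => ?_)
    have : τ (bridgeTime T α u) = u := by
      simp only [hτ]
      rw [bridgeClock_bridgeTime hT hα, max_eq_left hu.2, hK]
      ring
    rw [this]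
    exact hu.1
  have hR : Tendsto (fun t => (T - t) ^ α * lilScale (τ t) /
      √(2 * (T - t) / (2 * α - 1) * Real.log (Real.log (1 / (T - t))))) (𝓝[<] T) (𝓝 1) :=
    (tendsto_rpow_mul_lilScale_div hα K).comp (tendsto_const_sub_nhdsLT T)
  refine ⟨limsup_coe_eq_of_forall (fun a ha => ?_) fun a ha => ?_,
    limsup_coe_eq_top_of_forall fun c => ?_⟩
  · have hlt : (1 + a) / 2 * 1 < a := by linarith
    filter_upwards [hup ((1 + a) / 2) (by linarith), hmem,
      (hR.const_mul ((1 + a) / 2)).eventually (gt_mem_nhds hlt)] with t ht htT hRt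
    have hp : 0 ≤ (T - t) ^ α := Real.rpow_nonneg (sub_nonneg.2 htT.2.le) _
    rw [alphaWienerBridge_eq_rpow_mul B htT.1 htT.2]
    refine le_trans ?_ hRt.le
    rw [← mul_div_assoc, mul_left_comm]
    gcongr
  · set b := max a 0 with hb
    have hb1 : b < 1 := max_lt ha one_pos
    have hab : a ≤ b := le_max_left _ _
    have hlt : b < (1 + b) / 2 * 1 := by linarith
    refine ((hlow ((1 + b) / 2) (by linarith)).and_eventually (hmem.and
      ((hR.const_mul ((1 + b) / 2)).eventually (lt_mem_nhds hlt)))).mono ?_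
    rintro t ⟨ht, htT, hRt⟩
    have hp : 0 ≤ (T - t) ^ α := Real.rpow_nonneg (sub_nonneg.2 htT.2.le) _
    rw [alphaWienerBridge_eq_rpow_mul B htT.1 htT.2]
    refine (hab.trans hRt.le).trans ?_
    rw [← mul_div_assoc, mul_left_comm]
    gcongr
  · refine ((hlow (1 / 2) (by norm_num)).and_eventually (hmem.and
      ((tendsto_lilScale_atTop.comp hτt).eventually_ge_atTop (2 * c)))).mono ?_
    rintro t ⟨ht, htT, hct⟩
    have hp : (T - t) ^ α ≠ 0 := (Real.rpow_pos_of_pos (sub_pos.2 htT.2) _).ne'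
    rw [alphaWienerBridge_eq_rpow_mul B htT.1 htT.2, mul_div_cancel_left₀ _ hp]
    have : 2 * c ≤ lilScale (τ t) := hct
    linarith

/-- A Wiener process has a version with continuous paths. -/
lemma IsStandardWiener.exists_continuous {P : Measure Ω} {B : ℝ → Ω → ℝ}
    (hB : IsStandardWiener P B) :
    ∃ B' : ℝ → Ω → ℝ, IsStandardWiener P B' ∧ (∀ ω, Continuous fun t => B' t ω) ∧
      ∀ᵐ ω ∂P, ∀ t, B' t ω = B t ω := by
  obtain ⟨s, hs, hsm, hsc⟩ := Filter.Eventually.exists_measurable_mem hB.cont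
  have hae : ∀ᵐ ω ∂P, ∀ t, s.indicator (B t) ω = B t ω := by
    filter_upwards [hs] with ω hω t
    exact Set.indicator_of_mem hω _
  have hcont : ∀ ω, Continuous fun t => s.indicator (B t) ω := fun ω => by
    by_cases hω : ω ∈ s
    · simpa [hω] using hsc ω hω
    · simpa [hω] using continuous_const
  have hincr : ∀ u t, (fun ω => B t ω - B u ω) =ᵐ[P]
      fun ω => s.indicator (B t) ω - s.indicator (B u) ω := fun u t => by
    filter_upwards [hae] with ω hω
    rw [hω, hω]
  refine ⟨fun t => s.indicator (B t), ⟨fun t => (hB.meas t).indicator hsm, ?_,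
    Eventually.of_forall hcont, fun u t hu hut => ?_, fun u t hu hut => ?_⟩, hcont, hae⟩
  · filter_upwards [hae, hB.init] with ω hω h0
    rw [hω, h0]
  · refine (hB.incr_indep u t hu hut).congr (hincr u t) ?_
    filter_upwards [hae] with ω hω
    ext r
    rw [hω]
  · rw [← hB.incr_law u t hu hut]
    exact Measure.map_congr (hincr u t).symm

lemma IsStandardWiener.ae_limsup_alphaWienerBridge {P : Measure Ω} [IsProbabilityMeasure P]
    {T α : ℝ} (hT : 0 < T) (hα : 1 / 2 < α) {B : ℝ → Ω → ℝ} (hB : IsStandardWiener P B) :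
    ∀ᵐ ω ∂P, Filter.limsup (fun t => ((alphaWienerBridge T α B t ω /
        √(2 * (T - t) / (2 * α - 1) * Real.log (Real.log (1 / (T - t)))) : ℝ) : EReal))
          (𝓝[<] T) = 1 ∧
      Filter.limsup (fun t => ((alphaWienerBridge T α B t ω / (T - t) ^ α : ℝ) : EReal))
          (𝓝[<] T) = ⊤ := by
  obtain ⟨B', hB', hc, hBB'⟩ := hB.exists_continuous
  filter_upwards [hBB', (hB'.timeChange hT hα hc).ae_lil fun ω =>
    continuous_bridgeMartingale_bridgeTime hT hα (hc ω)] with ω hω hlil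
  have h := limsup_alphaWienerBridge_of_lil hT hα hlil.1 hlil.2
  simpa only [alphaWienerBridge, hω] using h

/-- Law of the iterated logarithm for the `α`-Wiener bridge when `α > 1/2`:
a.s. `limsup_{t↑T} X^{(α)}_t/√((2(T−t)/(2α−1)) ln ln (1/(T−t))) = 1` and the corresponding
`liminf` is `−1`; in particular a.s. `limsup_{t↑T} X^{(α)}_t/(T−t)^α = ∞` and
`liminf_{t↑T} X^{(α)}_t/(T−t)^α = −∞`. -/
theorem lil_alphaWienerBridge_of_half_lt
    (P : Measure Ω) [IsProbabilityMeasure P]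
    (T α : ℝ) (hT : 0 < T) (hα : 1/2 < α) (B : ℝ → Ω → ℝ) (hB : IsStandardWiener P B) :
    (∀ᵐ ω ∂P, Filter.limsup (fun t =>
        ((alphaWienerBridge T α B t ω /
          Real.sqrt (2 * (T - t) / (2*α - 1) * Real.log (Real.log (1/(T - t)))) : ℝ) : EReal))
        (𝓝[<] T) = 1) ∧
    (∀ᵐ ω ∂P, Filter.liminf (fun t =>
        ((alphaWienerBridge T α B t ω /
          Real.sqrt (2 * (T - t) / (2*α - 1) * Real.log (Real.log (1/(T - t)))) : ℝ) : EReal))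
        (𝓝[<] T) = -1) ∧
    (∀ᵐ ω ∂P, Filter.limsup (fun t =>
        ((alphaWienerBridge T α B t ω / (T - t) ^ α : ℝ) : EReal)) (𝓝[<] T) = ⊤) ∧
    (∀ᵐ ω ∂P, Filter.liminf (fun t =>
        ((alphaWienerBridge T α B t ω / (T - t) ^ α : ℝ) : EReal)) (𝓝[<] T) = ⊥) := by
  have h1 := hB.ae_limsup_alphaWienerBridge hT hα
  have h2 := hB.neg.ae_limsup_alphaWienerBridge hT hα
  refine ⟨h1.mono fun ω h => h.1, h2.mono fun ω h => ?_, h1.mono fun ω h => h.2,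
    h2.mono fun ω h => ?_⟩
  · have h := h.1
    simp only [alphaWienerBridge_neg, neg_div, EReal.coe_neg] at h
    rw [← neg_eq_iff_eq_neg, ← h]
    exact EReal.limsup_neg.symm
  · have h := h.2
    simp only [alphaWienerBridge_neg, neg_div, EReal.coe_neg] at h
    rw [← EReal.neg_eq_top_iff, ← h]
    exact EReal.limsup_neg.symm
end
end
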